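/- arXiv:1704.01091 — 6 statements merged into one kernel-verified Lean document; each statement's English description precedes it below -/
import Mathlib

section
/- Let (W,S) be a finite Coxeter system which is a direct product of irreducible finite Coxeter systems, each of whose Coxeter numbers is at least 5 (for Weyl groups this is exactly the condition that no irreducible factor is of type A_1, A_2, A_3 or B_2). Then every fat ideal I of the Bruhat order on W contains every element w in W with length l(w) at most 2, i.e., every product of at most two simple reflections lies in I. -/
/-- The Bruhat order on a Coxeter group: `x ≤ y` if and only if `x` is the product of
a subword of some reduced word for `y`. -/
def CoxeterSystem.bruhatLE {B W : Type*} [Group W] {M : CoxeterMatrix B}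
    (cs : CoxeterSystem M W) (x y : W) : Prop :=
  ∃ ω : List B, cs.IsReduced ω ∧ cs.wordProd ω = y ∧
    ∃ ω' : List B, ω'.Sublist ω ∧ cs.wordProd ω' = x

/-- Two indices lie in the same irreducible component of a Coxeter system iff they are
related by the equivalence closure of adjacency in the Coxeter diagram (distinct indices
`a`, `b` are adjacent iff `M a b ≠ 2`). -/
def CoxeterMatrix.SameComponent {B : Type*} (M : CoxeterMatrix B) (i j : B) : Prop :=
  Relation.EqvGen (fun a b => a ≠ b ∧ M a b ≠ 2) i j

/-- The sequence `a, b, c * b - a, …` in which each term is `c` times the previous term minus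
the one before it. -/
def chebyshevSeq (c a b : ℝ) : ℕ → ℝ
  | 0 => a
  | 1 => b
  | n + 2 => c * chebyshevSeq c a b (n + 1) - chebyshevSeq c a b n

theorem sin_mul_chebyshevSeq (θ a b : ℝ) (n : ℕ) :
    Real.sin θ * chebyshevSeq (2 * Real.cos θ) a b n =
      Real.sin ((n + 1) * θ) * a + Real.sin (n * θ) * (b - 2 * Real.cos θ * a) := by
  have key : ∀ x : ℝ, Real.sin (x + θ + θ) = 2 * Real.cos θ * Real.sin (x + θ) - Real.sin x := by
    intro x
    have h1 := Real.sin_add (x + θ) θ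
    have h2 := Real.sin_sub (x + θ) θ
    rw [add_sub_cancel_right] at h2
    linarith
  induction n using Nat.twoStepInduction with
  | zero => simp [chebyshevSeq]
  | one =>
    have h := Real.sin_two_mul θ
    norm_num [chebyshevSeq, h]
    ring
  | more n ih1 ih2 =>
    have e1 := key (n * θ)
    have e2 := key ((n + 1) * θ)
    rw [show (n : ℝ) * θ + θ + θ = (n + 2) * θ by ring,
      show (n : ℝ) * θ + θ = (n + 1) * θ by ring] at e1
    rw [show ((n : ℝ) + 1) * θ + θ + θ = (n + 2 + 1) * θ by ring,
      show ((n : ℝ) + 1) * θ + θ = (n + 1 + 1) * θ by ring] at e2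
    push_cast at ih2 ⊢
    rw [e1, e2, chebyshevSeq]
    linear_combination 2 * Real.cos θ * ih2 - ih1

theorem chebyshevSeq_two (a b : ℝ) (n : ℕ) : chebyshevSeq 2 a b n = a + n * (b - a) := by
  induction n using Nat.twoStepInduction with
  | zero => simp [chebyshevSeq]
  | one => simp [chebyshevSeq]
  | more n ih1 ih2 =>
    rw [chebyshevSeq, ih1, ih2]
    push_cast
    ring

namespace CoxeterMatrix

variable {B : Type*} (M : CoxeterMatrix B)

theorem two_cos_pi_div_diagonal (i : B) : 2 * Real.cos (Real.pi / M i i) = -2 := by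
  simp

/-- The action of a generator in the dual of the geometric representation: a linear form is
recorded by its values on the simple roots. -/
noncomputable def dualReflection (i : B) : Function.End (B → ℝ) :=
  fun f l => f l + 2 * Real.cos (Real.pi / M i l) * f i

theorem dualReflection_apply (i : B) (f : B → ℝ) (l : B) :
    M.dualReflection i f l = f l + 2 * Real.cos (Real.pi / M i l) * f i := rfl

theorem dualReflection_mul_pow_apply (i j : B) (f : B → ℝ) (n : ℕ) :
    let c := 2 * Real.cos (Real.pi / M i j)
    let y := chebyshevSeq c (f j) (f i + c * f j)
    (∀ l, ((M.dualReflection i * M.dualReflection j) ^ n) f l =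
      f l + 2 * Real.cos (Real.pi / M j l) * ∑ k ∈ Finset.range n, y (2 * k)
        + 2 * Real.cos (Real.pi / M i l) * ∑ k ∈ Finset.range n, y (2 * k + 1)) ∧
    ((M.dualReflection i * M.dualReflection j) ^ n) f j = y (2 * n) ∧
    ((M.dualReflection i * M.dualReflection j) ^ n) f i = y (2 * n + 1) - c * y (2 * n) := by
  intro c y
  have hji : 2 * Real.cos (Real.pi / M j i) = c := by rw [M.symmetric]
  have hij : 2 * Real.cos (Real.pi / M i j) = c := rfl
  have hy : ∀ k, y (k + 2) = c * y (k + 1) - y k := fun k => rfl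
  induction n with
  | zero =>
    refine ⟨fun l => ?_, ?_, ?_⟩
    · simp only [pow_zero, Finset.range_zero, Finset.sum_empty, mul_zero, add_zero]
      rfl
    · rfl
    · exact (add_sub_cancel_right (f i) (c * f j)).symm
  | succ n ih =>
    obtain ⟨h1, h2, h3⟩ := ih
    have step : ∀ l, ((M.dualReflection i * M.dualReflection j) ^ (n + 1)) f l =
        ((M.dualReflection i * M.dualReflection j) ^ n) f l
          + 2 * Real.cos (Real.pi / M j l) * y (2 * n)
          + 2 * Real.cos (Real.pi / M i l) * y (2 * n + 1) := by
      intro l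
      rw [pow_succ']
      change M.dualReflection i (M.dualReflection j
        (((M.dualReflection i * M.dualReflection j) ^ n) f)) l = _
      rw [dualReflection_apply, dualReflection_apply, dualReflection_apply, h2, h3, hji]
      ring
    refine ⟨fun l => ?_, ?_, ?_⟩
    · rw [step, h1, Finset.sum_range_succ, Finset.sum_range_succ]
      ring
    · rw [step, h2, two_cos_pi_div_diagonal, hij, show 2 * (n + 1) = 2 * n + 2 by ring, hy]
      ring
    · rw [step, h3, two_cos_pi_div_diagonal, hji, show 2 * (n + 1) + 1 = 2 * n + 1 + 2 by ring, hy,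
        show 2 * (n + 1) = 2 * n + 1 + 1 by ring]
      ring

theorem sin_pi_div_pos {i j : B} (hij : i ≠ j) (h0 : M i j ≠ 0) :
    0 < Real.sin (Real.pi / M i j) := by
  have h1 := M.off_diagonal i j hij
  have h2 : (2 : ℝ) ≤ M i j := by exact_mod_cast (by lia : 2 ≤ M i j)
  apply Real.sin_pos_of_pos_of_lt_pi
  · have := Real.pi_pos
    positivity
  · exact div_lt_self Real.pi_pos (by linarith)

theorem isLiftable_dualReflection : M.IsLiftable M.dualReflection := by
  intro i j
  by_cases h0 : M i j = 0
  · rw [h0, pow_zero]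
  by_cases hij : i = j
  · subst hij
    funext f
    funext l
    rw [M.diagonal, pow_one]
    change M.dualReflection i (M.dualReflection i f) l = f l
    rw [dualReflection_apply, dualReflection_apply, dualReflection_apply, two_cos_pi_div_diagonal]
    ring
  funext f
  funext l
  obtain ⟨h1, -, -⟩ := M.dualReflection_mul_pow_apply i j f (M i j)
  change ((M.dualReflection i * M.dualReflection j) ^ M i j) f l = f l
  rw [h1]
  set m := M i j with hm
  set θ := Real.pi / m with hθ
  set c := 2 * Real.cos θ with hc
  set y := chebyshevSeq c (f j) (f i + c * f j) with hy
  have hs : 0 < Real.sin θ := M.sin_pi_div_pos hij h0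
  have hmθ : (m : ℝ) * θ = Real.pi := by
    rw [hθ]
    field_simp
  have hper : ∀ k : ℕ, y (2 * m + k) = y k := by
    intro k
    apply mul_left_cancel₀ hs.ne'
    rw [hy, hc, sin_mul_chebyshevSeq, sin_mul_chebyshevSeq]
    push_cast
    rw [show (2 * (m : ℝ) + k + 1) * θ = (k + 1) * θ + 2 * Real.pi by linear_combination 2 * hmθ,
      show (2 * (m : ℝ) + k) * θ = k * θ + 2 * Real.pi by linear_combination 2 * hmθ,
      Real.sin_add_two_pi, Real.sin_add_two_pi]
  have hrec : ∀ k, y (k + 2) = c * y (k + 1) - y k := fun k => rfl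
  have shiftE : ∑ k ∈ Finset.range m, y (2 * k + 2) = ∑ k ∈ Finset.range m, y (2 * k) := by
    have a1 := Finset.sum_range_succ (fun k => y (2 * k)) m
    have a2 := Finset.sum_range_succ' (fun k => y (2 * k)) m
    have a3 := hper 0
    simp only [mul_add, mul_one, mul_zero, add_zero] at a1 a2 a3
    linarith
  have shiftO : ∑ k ∈ Finset.range m, y (2 * k + 3) = ∑ k ∈ Finset.range m, y (2 * k + 1) := by
    have a1 := Finset.sum_range_succ (fun k => y (2 * k + 1)) m
    have a2 := Finset.sum_range_succ' (fun k => y (2 * k + 1)) m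
    have a3 := hper 1
    simp only [mul_add, mul_one, mul_zero, zero_add, add_assoc] at a1 a2 a3
    norm_num at a1 a2
    linarith
  have e1 : ∑ k ∈ Finset.range m, y (2 * k + 2) =
      c * ∑ k ∈ Finset.range m, y (2 * k + 1) - ∑ k ∈ Finset.range m, y (2 * k) := by
    rw [Finset.mul_sum, ← Finset.sum_sub_distrib]
    exact Finset.sum_congr rfl fun k _ => hrec (2 * k)
  have e2 : ∑ k ∈ Finset.range m, y (2 * k + 3) =
      c * ∑ k ∈ Finset.range m, y (2 * k + 2) - ∑ k ∈ Finset.range m, y (2 * k + 1) := by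
    rw [Finset.mul_sum, ← Finset.sum_sub_distrib]
    exact Finset.sum_congr rfl fun k _ => hrec (2 * k + 1)
  rw [shiftE] at e1 e2
  rw [shiftO] at e2
  have hcs : 4 - c ^ 2 = 4 * Real.sin θ ^ 2 := by
    rw [hc]
    linear_combination -4 * Real.sin_sq_add_cos_sq θ
  have hne : 4 - c ^ 2 ≠ 0 := by
    rw [hcs]
    positivity
  have hE : ∑ k ∈ Finset.range m, y (2 * k) = 0 := by
    apply mul_left_cancel₀ hne
    linear_combination 2 * e1 + c * e2
  have hO : ∑ k ∈ Finset.range m, y (2 * k + 1) = 0 := by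
    rw [hE] at e2
    linarith
  rw [hE, hO]
  ring

end CoxeterMatrix

namespace CoxeterSystem

variable {B W : Type*} [Group W] {M : CoxeterMatrix B} (cs : CoxeterSystem M W)

theorem simple_mul_simple_pow_ne_one {i j : B} (hij : i ≠ j) {n : ℕ} (hn : 0 < n)
    (hnM : n < M i j ∨ M i j = 0) : (cs.simple i * cs.simple j) ^ n ≠ 1 := by
  classical
  intro h
  have h1 : (M.dualReflection i * M.dualReflection j) ^ n = 1 := by
    have := congrArg (cs.lift ⟨_, M.isLiftable_dualReflection⟩) h
    simpa using this
  have ha := (M.dualReflection_mul_pow_apply i j (Pi.single i 1) n).2.1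
  have hb := (M.dualReflection_mul_pow_apply i j (Pi.single j 1) n).2.1
  rw [h1] at ha hb
  change (Pi.single i 1 : B → ℝ) j = _ at ha
  change (Pi.single j 1 : B → ℝ) j = _ at hb
  simp only [Pi.single_eq_same, Pi.single_eq_of_ne hij, Pi.single_eq_of_ne hij.symm, mul_zero,
    add_zero, zero_add, mul_one] at ha hb
  by_cases h0 : M i j = 0
  · rw [h0] at ha
    norm_num [chebyshevSeq_two] at ha
    lia
  · replace hnM := hnM.resolve_right h0
    have hs := M.sin_pi_div_pos hij h0
    set θ := Real.pi / M i j with hθ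
    have ha' := sin_mul_chebyshevSeq θ 0 1 (2 * n)
    have hb' := sin_mul_chebyshevSeq θ 1 (2 * Real.cos θ) (2 * n)
    rw [← ha] at ha'
    rw [← hb] at hb'
    simp only [mul_zero, mul_one, sub_zero, sub_self, add_zero, zero_add] at ha' hb'
    rw [add_mul, one_mul, Real.sin_add, ← ha', zero_mul, zero_add] at hb'
    have hcos : Real.cos ((2 * n : ℕ) * θ) = 1 := by
      apply mul_right_cancel₀ hs.ne'
      linarith
    have hM : (0 : ℝ) < M i j := by exact_mod_cast Nat.pos_of_ne_zero h0
    have hlt : (n : ℝ) < M i j := by exact_mod_cast hnM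
    have hnpos : (0 : ℝ) < n := by exact_mod_cast hn
    have hpi := Real.pi_pos
    have hpos : 0 < ((2 * n : ℕ) : ℝ) * θ := by
      rw [hθ]
      push_cast
      positivity
    have hup : ((2 * n : ℕ) : ℝ) * θ < 2 * Real.pi := by
      rw [hθ]
      push_cast
      rw [mul_div_assoc', div_lt_iff₀ hM]
      nlinarith
    rw [Real.cos_eq_one_iff_of_lt_of_lt (by linarith) hup] at hcos
    linarith

section ReflectionCocycle

open Classical in
/-- The generators of the action of `W` on `W × ZMod 2` whose second component counts, modulo
two, how often an element occurs in an inversion sequence. -/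
noncomputable def signedConj (i : B) : Function.End (W × ZMod 2) :=
  fun p => (cs.simple i * p.1 * cs.simple i, p.2 + if p.1 = cs.simple i then 1 else 0)

open Classical in
theorem signedConj_mul_pow_apply (i j : B) (n : ℕ) (t : W) (ε : ZMod 2) :
    ((cs.signedConj i * cs.signedConj j) ^ n) (t, ε) =
      ((cs.simple i * cs.simple j) ^ n * t * ((cs.simple i * cs.simple j) ^ n)⁻¹,
        ε + ∑ q ∈ Finset.range (2 * n),
          if t = cs.simple j * (cs.simple i * cs.simple j) ^ q then 1 else 0) := by
  set c := cs.simple i * cs.simple j with hc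
  have hconj : ∀ k : ℕ, (c ^ k)⁻¹ * cs.simple j = cs.simple j * c ^ k := by
    intro k
    rw [← mul_left_inj (cs.simple j), cs.simple_mul_simple_cancel_right]
    have := conj_pow (i := k) (a := cs.simple j) (b := c)
    rw [cs.inv_simple] at this
    rw [← this, hc, ← inv_pow]
    simp [mul_assoc]
  induction n with
  | zero =>
    simp only [pow_zero, one_mul, inv_one, mul_one, mul_zero, Finset.range_zero, Finset.sum_empty,
      add_zero]
    rfl
  | succ n ih =>
    rw [pow_succ']
    change cs.signedConj i (cs.signedConj j (((cs.signedConj i * cs.signedConj j) ^ n) (t, ε))) = _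
    rw [ih]
    have h1 : c ^ n * t * (c ^ n)⁻¹ = cs.simple j ↔ t = cs.simple j * c ^ (2 * n) := by
      rw [mul_inv_eq_iff_eq_mul, ← eq_inv_mul_iff_mul_eq, ← mul_assoc, hconj, mul_assoc, ← pow_add,
        two_mul]
    have h2 : cs.simple j * (c ^ n * t * (c ^ n)⁻¹) * cs.simple j = cs.simple i ↔
        t = cs.simple j * c ^ (2 * n + 1) := by
      rw [← mul_left_inj (cs.simple j), cs.simple_mul_simple_cancel_right, ← hc,
        ← mul_right_inj (cs.simple j), cs.simple_mul_simple_cancel_left,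
        mul_inv_eq_iff_eq_mul, ← eq_inv_mul_iff_mul_eq, ← mul_assoc, ← mul_assoc, hconj,
        mul_assoc, mul_assoc, ← pow_succ', ← pow_add]
      ring_nf
    rw [show 2 * (n + 1) = 2 * n + 1 + 1 by ring, Finset.sum_range_succ, Finset.sum_range_succ]
    apply Prod.ext
    · simp only [signedConj, pow_succ', mul_inv_rev]
      simp [hc, mul_assoc]
    · simp only [signedConj, h1, h2, add_assoc]

theorem isLiftable_signedConj : M.IsLiftable cs.signedConj := by
  classical
  intro i j
  funext ⟨t, ε⟩
  rw [signedConj_mul_pow_apply, cs.simple_mul_simple_pow, two_mul, Finset.sum_range_add]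
  simp only [pow_add, cs.simple_mul_simple_pow, one_mul, inv_one, mul_one, CharTwo.add_self_eq_zero,
    add_zero]
  rfl

/-- The parity of the number of occurrences of `t` in the right inversion sequence of any word
for `w`. -/
noncomputable def inversionParity (w t : W) : ZMod 2 :=
  (cs.lift ⟨_, cs.isLiftable_signedConj⟩ w (t, 0)).2

theorem lift_signedConj_apply (w t : W) (ε : ZMod 2) :
    cs.lift ⟨_, cs.isLiftable_signedConj⟩ w (t, ε) =
      (w * t * w⁻¹, ε + cs.inversionParity w t) := by
  have key : ∀ w : W, ∀ ε, cs.lift ⟨_, cs.isLiftable_signedConj⟩ w (t, ε) =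
      (w * t * w⁻¹, ε + (cs.lift ⟨_, cs.isLiftable_signedConj⟩ w (t, 0)).2) := by
    intro w
    induction w using cs.simple_induction_left with
    | one =>
      intro ε
      rw [map_one]
      change (t, ε) = (1 * t * 1⁻¹, ε + 0)
      simp
    | mul_simple_left w i ih =>
      intro ε
      rw [map_mul, cs.lift_apply_simple]
      change cs.signedConj i _ = (_, ε + (cs.signedConj i _).2)
      rw [ih ε, ih 0]
      simp only [signedConj, mul_inv_rev, cs.inv_simple, mul_assoc, add_assoc, zero_add]
  exact key w ε

theorem inversionParity_mul (u v t : W) :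
    cs.inversionParity (u * v) t =
      cs.inversionParity v t + cs.inversionParity u (v * t * v⁻¹) := by
  have h : cs.lift ⟨_, cs.isLiftable_signedConj⟩ (u * v) (t, 0) =
      cs.lift ⟨_, cs.isLiftable_signedConj⟩ u (cs.lift ⟨_, cs.isLiftable_signedConj⟩ v (t, 0)) := by
    rw [map_mul]
    rfl
  simp only [lift_signedConj_apply] at h
  simpa using congrArg Prod.snd h

open Classical in
theorem inversionParity_simple (i : B) (t : W) :
    cs.inversionParity (cs.simple i) t = if t = cs.simple i then 1 else 0 := by
  rw [inversionParity, cs.lift_apply_simple]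
  simp [signedConj]

theorem inversionParity_simple_self (i : B) :
    cs.inversionParity (cs.simple i) (cs.simple i) = 1 := by
  simp [inversionParity_simple]

theorem inversionParity_one (t : W) : cs.inversionParity 1 t = 0 := by
  rw [inversionParity, map_one]
  rfl

theorem mem_rightInvSeq_of_inversionParity_ne_zero {ω : List B} {t : W}
    (h : cs.inversionParity (cs.wordProd ω) t ≠ 0) : t ∈ cs.rightInvSeq ω := by
  classical
  induction ω with
  | nil => simp [inversionParity_one] at h
  | cons i ω ih =>
    rw [rightInvSeq, List.mem_cons]
    by_cases hω : cs.inversionParity (cs.wordProd ω) t = 0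
    · left
      rw [wordProd_cons, inversionParity_mul, hω, zero_add, inversionParity_simple] at h
      have h' := of_not_not fun hn => h (if_neg hn)
      rw [← h']
      group
    · exact Or.inr (ih hω)

theorem length_mul_lt_of_inversionParity_ne_zero {w t : W} (h : cs.inversionParity w t ≠ 0) :
    cs.length (w * t) < cs.length w := by
  obtain ⟨ω, hω, rfl⟩ := cs.exists_isReduced w
  exact (cs.isRightInversion_of_mem_rightInvSeq hω
    (cs.mem_rightInvSeq_of_inversionParity_ne_zero h)).2

theorem IsReflection.inversionParity_self {cs : CoxeterSystem M W} {t : W}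
    (ht : cs.IsReflection t) : cs.inversionParity t t = 1 := by
  obtain ⟨x, i, rfl⟩ := ht
  have h := cs.inversionParity_mul x x⁻¹ (x * cs.simple i * x⁻¹)
  rw [mul_inv_cancel, inversionParity_one] at h
  rw [inversionParity_mul, inversionParity_mul]
  simp only [inv_inv, mul_assoc, inv_mul_cancel_left, inv_mul_cancel, mul_one, one_mul,
    cs.inv_simple, cs.simple_mul_simple_self, inversionParity_simple_self] at h ⊢
  linear_combination -h

theorem IsReflection.inversionParity_eq_zero_iff {cs : CoxeterSystem M W} {t : W}
    (ht : cs.IsReflection t) (w : W) :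
    cs.inversionParity w t = 0 ↔ ¬ cs.length (w * t) < cs.length w := by
  refine ⟨fun h => ?_, fun h => of_not_not fun hn =>
    h (cs.length_mul_lt_of_inversionParity_ne_zero hn)⟩
  have h1 : cs.inversionParity (w * t) t ≠ 0 := by
    rw [inversionParity_mul, ht.inversionParity_self, mul_inv_cancel_right, h]
    decide
  have h2 := cs.length_mul_lt_of_inversionParity_ne_zero h1
  rw [mul_assoc, ht.mul_self, mul_one] at h2
  lia

theorem inversionParity_simple_eq_zero_iff (w : W) (i : B) :
    cs.inversionParity w (cs.simple i) = 0 ↔ ¬ cs.IsRightDescent w i :=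
  (cs.isReflection_simple i).inversionParity_eq_zero_iff w

end ReflectionCocycle

section Dihedral

theorem simple_ne_simple {i j : B} (hij : i ≠ j) : cs.simple i ≠ cs.simple j := by
  intro h
  have h1 := M.off_diagonal i j hij
  refine cs.simple_mul_simple_pow_ne_one hij one_pos (by lia) ?_
  rw [h, pow_one, cs.simple_mul_simple_self]

theorem wordProd_eq_one_of_inversionParity_eq_zero (S : Set B) {ω : List B} (hω : ∀ x ∈ ω, x ∈ S)
    (h : ∀ x ∈ S, cs.inversionParity (cs.wordProd ω) (cs.simple x) = 0) :
    cs.wordProd ω = 1 := by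
  induction hn : ω.length using Nat.strong_induction_on generalizing ω with
  | _ n ih =>
    rcases List.eq_nil_or_concat ω with rfl | ⟨ω', x, rfl⟩
    · simp
    · have hx : x ∈ S := hω x (by simp)
      have hpar : cs.inversionParity (cs.wordProd ω') (cs.simple x) ≠ 0 := by
        have h1 := h x hx
        rw [wordProd_concat, inversionParity_mul, inversionParity_simple_self,
          mul_inv_cancel_right] at h1
        intro h0
        rw [h0] at h1
        revert h1
        decide
      obtain ⟨k, hk, hk'⟩ := List.mem_iff_getElem.mp
        (cs.mem_rightInvSeq_of_inversionParity_ne_zero hpar)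
      have heq : cs.wordProd (ω'.concat x) = cs.wordProd (ω'.eraseIdx k) := by
        rw [wordProd_concat, ← wordProd_mul_getD_rightInvSeq, List.getD_eq_getElem _ _ hk, hk']
      rw [heq] at h ⊢
      rw [length_rightInvSeq] at hk
      refine ih _ ?_ (fun y hy => hω y ?_) h rfl
      · rw [← hn, List.length_eraseIdx_of_lt hk, List.length_concat]
        lia
      · have := List.mem_of_mem_eraseIdx hy
        simp [this]

/-- If `v` has no right descent in `S` then it is the minimal representative of its coset modulo
the subgroup generated by `S`. -/
theorem length_le_length_mul_wordProd (S : Set B) {v : W} (hv : ∀ x ∈ S, ¬ cs.IsRightDescent v x)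
    {ω : List B} (hω : ∀ x ∈ ω, x ∈ S) : cs.length v ≤ cs.length (v * cs.wordProd ω) := by
  classical
  let P : ℕ → Prop := fun n => ∃ ω : List B, (∀ x ∈ ω, x ∈ S) ∧ cs.length (v * cs.wordProd ω) = n
  have hP : ∃ n, P n := ⟨_, [], by simp, rfl⟩
  obtain ⟨ω₀, hω₀, hmin⟩ := Nat.find_spec hP
  set y := v * cs.wordProd ω₀ with hy
  have hle : ∀ ω : List B, (∀ x ∈ ω, x ∈ S) → cs.length y ≤ cs.length (v * cs.wordProd ω) :=
    fun ω hω => hmin ▸ Nat.find_min' hP ⟨ω, hω, rfl⟩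
  have hrev : ∀ x ∈ ω₀.reverse, x ∈ S := fun x hx => hω₀ x (by simpa using hx)
  have hvy : v = y * cs.wordProd ω₀.reverse := by simp [hy]
  have hpar : ∀ x ∈ S, cs.inversionParity (cs.wordProd ω₀.reverse) (cs.simple x) = 0 := by
    intro x hx
    have h1 := (cs.inversionParity_simple_eq_zero_iff v x).mpr (hv x hx)
    rw [hvy, inversionParity_mul] at h1
    have h2 := ((cs.isReflection_simple x).conj
      (cs.wordProd ω₀.reverse)).inversionParity_eq_zero_iff y
    rw [h2.mpr, add_zero] at h1
    · exact h1
    · have h3 := hle (ω₀ ++ (ω₀.reverse ++ [x] ++ ω₀)) (by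
        intro z hz
        simp only [List.mem_append, List.mem_reverse, List.mem_singleton] at hz
        rcases hz with h | ((h | rfl) | h)
        exacts [hω₀ z h, hω₀ z h, hx, hω₀ z h])
      rw [not_lt]
      convert! h3 using 1
      simp [hy, wordProd_append, wordProd_cons, mul_assoc]
  have h1 := cs.wordProd_eq_one_of_inversionParity_eq_zero S hrev hpar
  rw [h1, mul_one] at hvy
  rw [hvy]
  simpa [hvy] using hle ω hω

theorem isRightDescent_mul_wordProd_iff (S : Set B) {v : W}
    (hv : ∀ x ∈ S, ¬ cs.IsRightDescent v x) {ω : List B} (hω : ∀ x ∈ ω, x ∈ S) {i : B}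
    (hi : i ∈ S) :
    cs.IsRightDescent (v * cs.wordProd ω) i ↔ cs.IsRightDescent (cs.wordProd ω) i := by
  rw [← not_iff_not, ← inversionParity_simple_eq_zero_iff, ← inversionParity_simple_eq_zero_iff,
    inversionParity_mul, (((cs.isReflection_simple i).conj
      (cs.wordProd ω)).inversionParity_eq_zero_iff v).mpr, add_zero]
  rw [not_lt]
  have h := cs.length_le_length_mul_wordProd S hv (ω := ω ++ ([i] ++ ω.reverse)) (by
    intro z hz
    simp only [List.mem_append, List.mem_reverse, List.mem_singleton] at hz
    rcases hz with h | rfl | h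
    exacts [hω z h, hi, hω z h])
  simpa [wordProd_append, wordProd_cons, mul_assoc] using h

theorem mem_rightInvSeq_of_isRightDescent {ω : List B} {i : B}
    (h : cs.IsRightDescent (cs.wordProd ω) i) : cs.simple i ∈ cs.rightInvSeq ω := by
  apply cs.mem_rightInvSeq_of_inversionParity_ne_zero
  rw [Ne, inversionParity_simple_eq_zero_iff]
  exact not_not_intro h

variable {cs}

theorem not_isRightDescent_mul {v : W} {i j : B} (hij : i ≠ j) (hi : ¬ cs.IsRightDescent v i)
    (hj : ¬ cs.IsRightDescent v j) : ¬ cs.IsRightDescent (v * cs.simple j) i := by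
  have h := cs.isRightDescent_mul_wordProd_iff {i, j} (v := v) (by simp [hi, hj]) (ω := [j])
    (by simp) (i := i) (by simp)
  rw [wordProd_singleton] at h
  rw [h]
  intro hd
  rw [← cs.wordProd_singleton] at hd
  have := cs.mem_rightInvSeq_of_isRightDescent hd
  simp only [rightInvSeq, wordProd_nil, inv_one, one_mul, mul_one, List.mem_singleton] at this
  exact cs.simple_ne_simple hij this

theorem not_isRightDescent_mul_mul {v : W} {i j : B} (hij : i ≠ j) (hM : 3 ≤ M i j)
    (hi : ¬ cs.IsRightDescent v i) (hj : ¬ cs.IsRightDescent v j) :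
    ¬ cs.IsRightDescent (v * cs.simple i * cs.simple j) i := by
  have h := cs.isRightDescent_mul_wordProd_iff {i, j} (v := v) (by simp [hi, hj]) (ω := [i, j])
    (by simp) (i := i) (by simp)
  simp only [wordProd_cons, wordProd_nil, mul_one, ← mul_assoc] at h
  rw [h]
  intro hd
  have := cs.mem_rightInvSeq_of_isRightDescent (ω := [i, j]) (by simpa [wordProd_cons] using hd)
  simp only [rightInvSeq, wordProd_nil, wordProd_cons, inv_one, one_mul, mul_one, List.mem_cons,
    List.not_mem_nil, or_false, cs.inv_simple] at this
  rcases this with e | e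
  · apply cs.simple_mul_simple_pow_ne_one hij (n := 2) (by simp) (by lia)
    rw [pow_two]
    nth_rw 1 [e]
    simp [mul_assoc]
  · exact cs.simple_ne_simple hij e

theorem not_isRightDescent_mul_mul_mul {v : W} {i j : B} (hij : i ≠ j) (hM : 4 ≤ M i j)
    (hi : ¬ cs.IsRightDescent v i) (hj : ¬ cs.IsRightDescent v j) :
    ¬ cs.IsRightDescent (v * cs.simple j * cs.simple i * cs.simple j) i := by
  have h := cs.isRightDescent_mul_wordProd_iff {i, j} (v := v) (by simp [hi, hj]) (ω := [j, i, j])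
    (by simp) (i := i) (by simp)
  simp only [wordProd_cons, wordProd_nil, mul_one, ← mul_assoc] at h
  rw [h]
  intro hd
  have := cs.mem_rightInvSeq_of_isRightDescent (ω := [j, i, j])
    (by simpa [wordProd_cons, mul_assoc] using hd)
  simp only [rightInvSeq, wordProd_nil, wordProd_cons, inv_one, one_mul, mul_one, List.mem_cons,
    List.not_mem_nil, or_false, cs.inv_simple, mul_inv_rev] at this
  rcases this with e | e | e
  · apply cs.simple_mul_simple_pow_ne_one hij (n := 3) (by simp) (by lia)
    simp only [pow_succ, pow_zero, one_mul]
    nth_rw 1 [e]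
    simp [mul_assoc]
  · apply cs.simple_mul_simple_pow_ne_one hij (n := 2) (by simp) (by lia)
    rw [pow_two]
    nth_rw 1 [e]
    simp [mul_assoc]
  · exact cs.simple_ne_simple hij e

theorem not_isRightDescent_mul_mul_mul_mul {v : W} {i j : B} (hij : i ≠ j) (hM : 5 ≤ M i j)
    (hi : ¬ cs.IsRightDescent v i) (hj : ¬ cs.IsRightDescent v j) :
    ¬ cs.IsRightDescent
      (v * cs.simple i * cs.simple j * cs.simple i * cs.simple j) i := by
  have h := cs.isRightDescent_mul_wordProd_iff {i, j} (v := v) (by simp [hi, hj])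
    (ω := [i, j, i, j]) (by simp) (i := i) (by simp)
  simp only [wordProd_cons, wordProd_nil, mul_one, ← mul_assoc] at h
  rw [h]
  intro hd
  have := cs.mem_rightInvSeq_of_isRightDescent (ω := [i, j, i, j])
    (by simpa [wordProd_cons, mul_assoc] using hd)
  simp only [rightInvSeq, wordProd_nil, wordProd_cons, inv_one, one_mul, mul_one, List.mem_cons,
    List.not_mem_nil, or_false, cs.inv_simple, mul_inv_rev] at this
  rcases this with e | e | e | e
  · apply cs.simple_mul_simple_pow_ne_one hij (n := 4) (by simp) (by lia)
    simp only [pow_succ, pow_zero, one_mul]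
    nth_rw 1 [e]
    simp [mul_assoc]
  · apply cs.simple_mul_simple_pow_ne_one hij (n := 3) (by simp) (by lia)
    simp only [pow_succ, pow_zero, one_mul]
    nth_rw 1 [e]
    simp [mul_assoc]
  · apply cs.simple_mul_simple_pow_ne_one hij (n := 2) (by simp) (by lia)
    rw [pow_two]
    nth_rw 1 [e]
    simp [mul_assoc]
  · exact cs.simple_ne_simple hij e

end Dihedral

end CoxeterSystem

theorem CoxeterMatrix.SameComponent.mem {B : Type*} {M : CoxeterMatrix B} {S : Set B}
    (hS : ∀ a ∈ S, ∀ b, a ≠ b → M a b ≠ 2 → b ∈ S) {i j : B} (h : M.SameComponent i j)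
    (hi : i ∈ S) : j ∈ S := by
  have key : i ∈ S ↔ j ∈ S := by
    clear hi
    induction h with
    | rel a b hab =>
      exact ⟨fun ha => hS a ha b hab.1 hab.2,
        fun hb => hS b hb a hab.1.symm (by rw [M.symmetric]; exact hab.2)⟩
    | refl a => exact Iff.rfl
    | symm a b _ ih => exact ih.symm
    | trans a b c _ _ ih₁ ih₂ => exact ih₁.trans ih₂
  exact key.mp hi

theorem CoxeterMatrix.sameComponent_of_adj {B : Type*} {M : CoxeterMatrix B} {i j : B}
    (hij : i ≠ j) (hM : 3 ≤ M i j) : M.SameComponent i j :=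
  Relation.EqvGen.rel _ _ ⟨hij, by lia⟩

namespace CoxeterSystem

variable {B W : Type*} [Group W] {M : CoxeterMatrix B} (cs : CoxeterSystem M W)

include cs in
theorem matrix_ne_zero_of_finite [Finite W] (i j : B) : M i j ≠ 0 := by
  intro h
  have hij : i ≠ j := by
    rintro rfl
    simp at h
  exact cs.simple_mul_simple_pow_ne_one hij (orderOf_pos (cs.simple i * cs.simple j)) (Or.inr h)
    (pow_orderOf_eq_one _)

include cs in
theorem three_le_of_ne_two [Finite W] {i j : B} (hij : i ≠ j) (h : M i j ≠ 2) : 3 ≤ M i j := by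
  have h0 := cs.matrix_ne_zero_of_finite i j
  have h1 := M.off_diagonal i j hij
  lia

theorem simple_mul_comm {i j : B} (h : M i j = 2) :
    cs.simple i * cs.simple j = cs.simple j * cs.simple i := by
  have h1 := cs.simple_mul_simple_pow i j
  rw [h, pow_two, mul_eq_one_iff_eq_inv] at h1
  simpa using h1

theorem mul_simple_mul_comm (v : W) {i j : B} (h : M i j = 2) :
    v * cs.simple i * cs.simple j = v * cs.simple j * cs.simple i := by
  rw [mul_assoc, cs.simple_mul_comm h, ← mul_assoc]

/-- Each letter of the word `ω`, multiplied successively to `v` on the right, increases the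
length. -/
def LengthIncreasing (v : W) : List B → Prop
  | [] => True
  | i :: ω => ¬ cs.IsRightDescent v i ∧ LengthIncreasing (v * cs.simple i) ω

theorem LengthIncreasing.length_mul_wordProd {cs : CoxeterSystem M W} {v : W} {ω : List B}
    (h : cs.LengthIncreasing v ω) :
    cs.length (v * cs.wordProd ω) = cs.length v + ω.length := by
  induction ω generalizing v with
  | nil => simp
  | cons i ω ih =>
    have h1 := ih h.2
    have h2 := cs.not_isRightDescent_iff.mp h.1
    rw [wordProd_cons, ← mul_assoc, h1, h2, List.length_cons]
    ring

theorem LengthIncreasing.isReduced {cs : CoxeterSystem M W} {ω : List B}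
    (h : cs.LengthIncreasing 1 ω) : cs.IsReduced ω := by
  have := h.length_mul_wordProd
  simpa [IsReduced] using this

section Words

variable {cs} {s t u v : B}

theorem isReduced_of_adj (hst : s ≠ t) (hM : 3 ≤ M s t) : cs.IsReduced [s, t, s] := by
  have d0 := cs.not_isRightDescent_one
  exact LengthIncreasing.isReduced ⟨d0 s, not_isRightDescent_mul hst.symm (d0 t) (d0 s),
    not_isRightDescent_mul_mul hst hM (d0 s) (d0 t), trivial⟩

/-- The case of a path `s - t - u`. -/
theorem isReduced_of_adj_right (hst : s ≠ t) (hM : 3 ≤ M s t) (hus : u ≠ s) (hut : u ≠ t)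
    (hMu : 3 ≤ M t u) : cs.IsReduced [s, t, u, t, s] := by
  have d0 := cs.not_isRightDescent_one
  have s_t := not_isRightDescent_mul hst.symm (d0 t) (d0 s)
  have s_u := not_isRightDescent_mul hus (d0 u) (d0 s)
  have st_s := not_isRightDescent_mul_mul hst hM (d0 s) (d0 t)
  have st_u := not_isRightDescent_mul hut s_u s_t
  have stu_t := not_isRightDescent_mul_mul hut.symm hMu s_t s_u
  have stu_s := not_isRightDescent_mul hus.symm st_s st_u
  have stut_s := not_isRightDescent_mul hst stu_s stu_t
  exact LengthIncreasing.isReduced ⟨d0 s, s_t, st_u, stu_t, stut_s, trivial⟩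

theorem isReduced_of_five_le (hst : s ≠ t) (hM : 5 ≤ M s t) : cs.IsReduced [s, t, s, t, s] := by
  have d0 := cs.not_isRightDescent_one
  have hM' : 4 ≤ M t s := by
    rw [M.symmetric]
    lia
  exact LengthIncreasing.isReduced ⟨d0 s, not_isRightDescent_mul hst.symm (d0 t) (d0 s),
    not_isRightDescent_mul_mul hst (by lia) (d0 s) (d0 t),
    not_isRightDescent_mul_mul_mul hst.symm hM' (d0 t) (d0 s),
    not_isRightDescent_mul_mul_mul_mul hst hM (d0 s) (d0 t), trivial⟩

/-- The case of a path `t - s - u` with `4 ≤ M s t`. -/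
theorem isReduced_of_four_le (hst : s ≠ t) (hM : 4 ≤ M s t) (hus : u ≠ s) (hut : u ≠ t)
    (hMu : 3 ≤ M s u) : cs.IsReduced [s, t, s, u, s, t, s] := by
  have d0 := cs.not_isRightDescent_one
  have hM' : 4 ≤ M t s := by rwa [M.symmetric]
  have s_t := not_isRightDescent_mul hst.symm (d0 t) (d0 s)
  have s_u := not_isRightDescent_mul hus (d0 u) (d0 s)
  have st_s := not_isRightDescent_mul_mul hst (by lia) (d0 s) (d0 t)
  have st_u := not_isRightDescent_mul hut s_u s_t
  have sts_t := not_isRightDescent_mul_mul_mul hst.symm hM' (d0 t) (d0 s)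
  have sts_u := not_isRightDescent_mul hus st_u st_s
  have stsu_s := not_isRightDescent_mul_mul hus.symm hMu st_s st_u
  have stsu_t := not_isRightDescent_mul hut.symm sts_t sts_u
  have stsus_t := not_isRightDescent_mul hst.symm stsu_t stsu_s
  have stsust_s := not_isRightDescent_mul_mul hst (by lia) stsu_s stsu_t
  exact LengthIncreasing.isReduced
    ⟨d0 s, s_t, st_s, sts_u, stsu_s, stsus_t, stsust_s, trivial⟩

/-- For a path `t - s - u`, the letter `t` lengthens the word `s t u s`. -/
theorem not_isRightDescent_of_path (hst : s ≠ t) (hM : 3 ≤ M s t) (hus : u ≠ s)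
    (hut : u ≠ t) (hMu : 3 ≤ M s u) (hMtu : M t u = 2) :
    ¬ cs.IsRightDescent (1 * cs.simple s * cs.simple t * cs.simple u * cs.simple s) t := by
  have d0 := cs.not_isRightDescent_one
  have s_t := not_isRightDescent_mul hst.symm (d0 t) (d0 s)
  have s_u := not_isRightDescent_mul hus (d0 u) (d0 s)
  have su_t := not_isRightDescent_mul hut.symm s_t s_u
  have su_s := not_isRightDescent_mul_mul hus.symm hMu (d0 s) (d0 u)
  rw [cs.mul_simple_mul_comm _ hMtu]
  exact not_isRightDescent_mul_mul hst.symm (by rwa [M.symmetric]) su_t su_s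

/-- The case of a path `t - s - u` with `4 ≤ M s u`. -/
theorem isReduced_of_four_le_right (hst : s ≠ t) (hM : 3 ≤ M s t) (hus : u ≠ s) (hut : u ≠ t)
    (hMu : 4 ≤ M s u) (hMtu : M t u = 2) : cs.IsReduced [s, t, u, s, u, t, s] := by
  have d0 := cs.not_isRightDescent_one
  have hMus : 3 ≤ M u s := by
    rw [M.symmetric]
    lia
  have s_t := not_isRightDescent_mul hst.symm (d0 t) (d0 s)
  have s_u := not_isRightDescent_mul hus (d0 u) (d0 s)
  have st_s := not_isRightDescent_mul_mul hst hM (d0 s) (d0 t)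
  have st_u := not_isRightDescent_mul hut s_u s_t
  have stu_s := not_isRightDescent_mul hus.symm st_s st_u
  have stus_u := not_isRightDescent_mul_mul hus hMus st_u st_s
  have stus_t := not_isRightDescent_of_path (cs := cs) hst hM hus hut (by lia) hMtu
  have stusu_s := not_isRightDescent_mul_mul_mul hus.symm hMu st_s st_u
  have stusu_t := not_isRightDescent_mul hut.symm stus_t stus_u
  have stusut_s := not_isRightDescent_mul hst stusu_s stusu_t
  exact LengthIncreasing.isReduced
    ⟨d0 s, s_t, st_u, stu_s, stus_u, stusu_t, stusut_s, trivial⟩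

/-- The case of a vertex `s` with three neighbours `t`, `u`, `v`. -/
theorem isReduced_of_star (hst : s ≠ t) (hM : 3 ≤ M s t) (hus : u ≠ s) (hut : u ≠ t)
    (hMu : 3 ≤ M s u) (hMtu : M t u = 2) (hvs : v ≠ s) (hvt : v ≠ t) (hvu : v ≠ u)
    (hMv : 3 ≤ M s v) : cs.IsReduced [s, t, u, s, v, t, s] := by
  have d0 := cs.not_isRightDescent_one
  have s_t := not_isRightDescent_mul hst.symm (d0 t) (d0 s)
  have s_u := not_isRightDescent_mul hus (d0 u) (d0 s)
  have s_v := not_isRightDescent_mul hvs (d0 v) (d0 s)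
  have st_s := not_isRightDescent_mul_mul hst hM (d0 s) (d0 t)
  have st_u := not_isRightDescent_mul hut s_u s_t
  have st_v := not_isRightDescent_mul hvt s_v s_t
  have stu_s := not_isRightDescent_mul hus.symm st_s st_u
  have stu_v := not_isRightDescent_mul hvu st_v st_u
  have stus_t := not_isRightDescent_of_path (cs := cs) hst hM hus hut hMu hMtu
  have stus_v := not_isRightDescent_mul hvs stu_v stu_s
  have stusv_t := not_isRightDescent_mul hvt.symm stus_t stus_v
  have stusv_s := not_isRightDescent_mul_mul hvs.symm hMv stu_s stu_v
  have stusvt_s := not_isRightDescent_mul hst stusv_s stusv_t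
  exact LengthIncreasing.isReduced
    ⟨d0 s, s_t, st_u, stu_s, stus_v, stusv_t, stusvt_s, trivial⟩

/-- The case of a path `t - s - u - v`. -/
theorem isReduced_of_path (hst : s ≠ t) (hM : 3 ≤ M s t) (hus : u ≠ s) (hut : u ≠ t)
    (hMu : 3 ≤ M s u) (hMtu : M t u = 2) (hvs : v ≠ s) (hvt : v ≠ t) (hvu : v ≠ u)
    (hMv : 3 ≤ M u v) (hMsv : M s v = 2) : cs.IsReduced [s, t, u, s, v, u, t, s] := by
  have d0 := cs.not_isRightDescent_one
  have s_t := not_isRightDescent_mul hst.symm (d0 t) (d0 s)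
  have s_u := not_isRightDescent_mul hus (d0 u) (d0 s)
  have s_v := not_isRightDescent_mul hvs (d0 v) (d0 s)
  have st_s := not_isRightDescent_mul_mul hst hM (d0 s) (d0 t)
  have st_u := not_isRightDescent_mul hut s_u s_t
  have st_v := not_isRightDescent_mul hvt s_v s_t
  have stu_s := not_isRightDescent_mul hus.symm st_s st_u
  have stu_v := not_isRightDescent_mul hvu st_v st_u
  have stus_t := not_isRightDescent_of_path (cs := cs) hst hM hus hut hMu hMtu
  have stus_u := not_isRightDescent_mul_mul hus (by rwa [M.symmetric]) st_u st_s
  have stus_v := not_isRightDescent_mul hvs stu_v stu_s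
  have stusv_t := not_isRightDescent_mul hvt.symm stus_t stus_v
  have stusv_u := not_isRightDescent_mul hvu.symm stus_u stus_v
  have stusvu_t := not_isRightDescent_mul hut.symm stusv_t stusv_u
  have stuv_s := not_isRightDescent_mul hvs.symm stu_s stu_v
  have stuv_u := not_isRightDescent_mul_mul hvu.symm hMv st_u st_v
  have stusvu_s := not_isRightDescent_mul_mul hus.symm hMu stuv_s stuv_u
  rw [← cs.mul_simple_mul_comm _ hMsv] at stusvu_s
  have stusvut_s := not_isRightDescent_mul hst stusvu_s stusvu_t
  exact LengthIncreasing.isReduced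
    ⟨d0 s, s_t, st_u, stu_s, stus_v, stusv_u, stusvu_t, stusvut_s, trivial⟩

/-- The case of commuting generators `s`, `t` with a common neighbour `u`. -/
theorem isReduced_of_comm_of_adj (hst : s ≠ t) (hM : M s t = 2) (hus : u ≠ s) (hut : u ≠ t)
    (hMsu : 3 ≤ M s u) (hMtu : 3 ≤ M t u) : cs.IsReduced [s, t, u, t, s] := by
  have d0 := cs.not_isRightDescent_one
  have s_t := not_isRightDescent_mul hst.symm (d0 t) (d0 s)
  have s_u := not_isRightDescent_mul hus (d0 u) (d0 s)
  have t_s := not_isRightDescent_mul hst (d0 s) (d0 t)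
  have t_u := not_isRightDescent_mul hut (d0 u) (d0 t)
  have st_u := not_isRightDescent_mul hut s_u s_t
  have stu_t := not_isRightDescent_mul_mul hut.symm hMtu s_t s_u
  have stu_s := not_isRightDescent_mul_mul hus.symm hMsu t_s t_u
  rw [← cs.mul_simple_mul_comm _ hM] at stu_s
  have stut_s := not_isRightDescent_mul hst stu_s stu_t
  exact LengthIncreasing.isReduced ⟨d0 s, s_t, st_u, stu_t, stut_s, trivial⟩

/-- The case of generators `s`, `t` with respective neighbours `u ≠ v`, where `t` and `u`
commute. -/
theorem isReduced_of_comm (hst : s ≠ t) (hus : u ≠ s) (hut : u ≠ t) (hvs : v ≠ s)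
    (hvt : v ≠ t) (hvu : v ≠ u) (hMsu : 3 ≤ M s u) (hMtv : 3 ≤ M t v) (hMtu : M t u = 2) :
    cs.IsReduced [s, t, u, v, t, s] := by
  have d0 := cs.not_isRightDescent_one
  have s_t := not_isRightDescent_mul hst.symm (d0 t) (d0 s)
  have s_u := not_isRightDescent_mul hus (d0 u) (d0 s)
  have s_v := not_isRightDescent_mul hvs (d0 v) (d0 s)
  have st_u := not_isRightDescent_mul hut s_u s_t
  have st_v := not_isRightDescent_mul hvt s_v s_t
  have stu_v := not_isRightDescent_mul hvu st_v st_u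
  have su_s := not_isRightDescent_mul_mul hus.symm hMsu (d0 s) (d0 u)
  have su_t := not_isRightDescent_mul hut.symm s_t s_u
  have su_v := not_isRightDescent_mul hvu s_v s_u
  have sut_s := not_isRightDescent_mul hst su_s su_t
  have sut_v := not_isRightDescent_mul hvt su_v su_t
  have sutv_s := not_isRightDescent_mul hvs.symm sut_s sut_v
  have sutv_t := not_isRightDescent_mul_mul hvt.symm hMtv su_t su_v
  have sutvt_s := not_isRightDescent_mul hst sutv_s sutv_t
  rw [← cs.mul_simple_mul_comm _ hMtu] at sutv_t sutvt_s
  exact LengthIncreasing.isReduced ⟨d0 s, s_t, st_u, stu_v, sutv_t, sutvt_s, trivial⟩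

theorem braid_of_eq_three {i j : B} (h : M i j = 3) :
    cs.simple i * cs.simple j * cs.simple i = cs.simple j * cs.simple i * cs.simple j := by
  have h1 := cs.simple_mul_simple_pow i j
  have h2 : (cs.simple i * cs.simple j * cs.simple i) *
      (cs.simple j * cs.simple i * cs.simple j) = 1 := by
    rw [← h1, h]
    simp only [pow_succ, pow_zero, one_mul, mul_assoc]
  rw [mul_eq_one_iff_eq_inv] at h2
  rw [h2]
  simp only [mul_inv_rev, inv_simple, mul_assoc]

theorem wordProd_pow_four_eq_one (hM : M s t = 3) (hMu : M s u = 3) (hMtu : M t u = 2) :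
    cs.wordProd [t, s, u] ^ 4 = 1 := by
  have hcomm := cs.simple_mul_comm hMtu
  have hsq : cs.wordProd [t, s, u] ^ 2 =
      cs.simple s * cs.simple t * cs.simple u * cs.simple s := by
    calc cs.wordProd [t, s, u] ^ 2
        = cs.simple t * cs.simple s * (cs.simple u * cs.simple t) * cs.simple s *
            cs.simple u := by
          simp only [wordProd_cons, wordProd_nil, mul_one, pow_two, mul_assoc]
      _ = cs.simple t * cs.simple s * cs.simple t *
            (cs.simple u * cs.simple s * cs.simple u) := by
          rw [← hcomm]
          simp only [mul_assoc]
      _ = _ := by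
          rw [← braid_of_eq_three hM, ← braid_of_eq_three hMu]
          simp [mul_assoc]
  have h4 : (cs.simple t * cs.simple u) ^ 2 = 1 := by
    rw [← hMtu, simple_mul_simple_pow]
  calc cs.wordProd [t, s, u] ^ 4 = cs.simple s * (cs.simple t * cs.simple u) ^ 2 * cs.simple s := by
        rw [pow_mul _ 2 2, hsq]
        simp [pow_two, mul_assoc]
    _ = 1 := by simp [h4]

end Words

variable [Finite W]
  (hCox : ∀ i : B, ∀ l : List B, l.Nodup →
    (∀ j : B, j ∈ l ↔ M.SameComponent i j) → 5 ≤ orderOf (cs.wordProd l))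
include hCox

theorem exists_adj_of_coxeterNumber (s : B) : ∃ t, t ≠ s ∧ 3 ≤ M s t := by
  by_contra! h
  have h5 := hCox s [s] (by simp) (fun j => by
    rw [List.mem_singleton]
    refine ⟨fun hj => hj ▸ Relation.EqvGen.refl _, fun hj => ?_⟩
    refine hj.mem (S := {s}) (fun a ha b hab hM => ?_) rfl
    obtain rfl : a = s := ha
    exact absurd (cs.three_le_of_ne_two hab hM) (h b hab.symm).not_ge)
  have := orderOf_le_of_pow_eq_one two_pos (cs.simple_sq s)
  rw [wordProd_singleton] at h5
  lia

theorem exists_isReduced_of_adj {s t : B} (hst : s ≠ t) (hM : 3 ≤ M s t) :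
    ∃ ω : List B, cs.IsReduced (ω ++ [t, s]) ∧ [s, t].Sublist ω := by
  by_cases h1 : ∃ u, u ≠ s ∧ u ≠ t ∧ 3 ≤ M t u
  · obtain ⟨u, hus, hut, hMu⟩ := h1
    exact ⟨[s, t, u], isReduced_of_adj_right hst hM hus hut hMu, by simp⟩
  push Not at h1
  have ht : ∀ b, t ≠ b → M t b ≠ 2 → b = s := fun b htb hb => by
    by_contra hbs
    exact absurd (cs.three_le_of_ne_two htb hb) (h1 b hbs htb.symm).not_ge
  by_cases h2 : 5 ≤ M s t
  · exact ⟨[s, t, s], isReduced_of_five_le hst h2, by simp⟩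
  by_cases h3 : ∃ u, u ≠ s ∧ u ≠ t ∧ 3 ≤ M s u
  swap
  · exfalso
    push Not at h3
    have h5 := hCox s [s, t] (by simp [hst]) (fun j => by
      constructor
      · intro hj
        simp only [List.mem_cons, List.not_mem_nil, or_false] at hj
        rcases hj with rfl | rfl
        · exact Relation.EqvGen.refl _
        · exact CoxeterMatrix.sameComponent_of_adj hst hM
      · intro hj
        have := hj.mem (S := {s, t}) (fun a ha b hab hb => ?_) (by simp)
        · simpa using this
        · rcases ha with rfl | rfl
          · by_contra hbS
            simp only [Set.mem_insert_iff, Set.mem_singleton_iff, not_or] at hbS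
            exact absurd (cs.three_le_of_ne_two hab hb) (h3 b hbS.1 hbS.2).not_ge
          · exact Or.inl (ht b hab hb))
    have := orderOf_le_of_pow_eq_one (by lia) (cs.simple_mul_simple_pow s t)
    simp only [wordProd_cons, wordProd_nil, mul_one] at h5
    lia
  obtain ⟨u, hus, hut, hMu⟩ := h3
  have hMtu : M t u = 2 := by
    by_contra h
    exact hus (ht u hut.symm h)
  by_cases h4 : 4 ≤ M s t
  · exact ⟨[s, t, s, u, s], isReduced_of_four_le hst h4 hus hut hMu, by simp⟩
  by_cases h5 : 4 ≤ M s u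
  · exact ⟨[s, t, u, s, u], isReduced_of_four_le_right hst hM hus hut h5 hMtu, by simp⟩
  by_cases h6 : ∃ v, v ≠ s ∧ v ≠ t ∧ v ≠ u ∧ 3 ≤ M s v
  · obtain ⟨v, hvs, hvt, hvu, hMv⟩ := h6
    exact ⟨[s, t, u, s, v], isReduced_of_star hst hM hus hut hMu hMtu hvs hvt hvu hMv, by simp⟩
  push Not at h6
  by_cases h7 : ∃ v, v ≠ s ∧ v ≠ t ∧ v ≠ u ∧ 3 ≤ M u v
  · obtain ⟨v, hvs, hvt, hvu, hMv⟩ := h7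
    have hMsv : M s v = 2 := by
      by_contra h
      exact absurd (cs.three_le_of_ne_two hvs.symm h) (h6 v hvs hvt hvu).not_ge
    exact ⟨[s, t, u, s, v, u],
      isReduced_of_path hst hM hus hut hMu hMtu hvs hvt hvu hMv hMsv, by simp⟩
  push Not at h7
  exfalso
  have h8 := hCox s [t, s, u] (by simp [hst.symm, hus.symm, hut.symm]) (fun j => by
    constructor
    · intro hj
      simp only [List.mem_cons, List.not_mem_nil, or_false] at hj
      rcases hj with rfl | rfl | rfl
      · exact CoxeterMatrix.sameComponent_of_adj hst hM
      · exact Relation.EqvGen.refl _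
      · exact CoxeterMatrix.sameComponent_of_adj hus.symm hMu
    · intro hj
      have := hj.mem (S := {t, s, u}) (fun a ha b hab hb => ?_) (by simp)
      · simpa using this
      · by_contra hbS
        simp only [Set.mem_insert_iff, Set.mem_singleton_iff, not_or] at hbS
        obtain ⟨hbt, hbs, hbu⟩ := hbS
        have h3 := cs.three_le_of_ne_two hab hb
        rcases ha with rfl | rfl | rfl
        · exact hbs (ht b hab hb)
        · exact absurd h3 (h6 b hbs hbt hbu).not_ge
        · exact absurd h3 (h7 b hbs hbt hbu).not_ge)
  have := orderOf_le_of_pow_eq_one (by lia) (wordProd_pow_four_eq_one (cs := cs) (s := s) (t := t)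
    (u := u) (by lia) (by lia) hMtu)
  lia

theorem exists_isReduced_of_ne {s t : B} (hst : s ≠ t) :
    ∃ ω : List B, cs.IsReduced (ω ++ [t, s]) ∧ [s, t].Sublist ω := by
  by_cases hM : M s t = 2
  swap
  · exact cs.exists_isReduced_of_adj hCox hst (cs.three_le_of_ne_two hst hM)
  have hMts : M t s = 2 := by rwa [M.symmetric]
  obtain ⟨u, hus, hMu⟩ := cs.exists_adj_of_coxeterNumber hCox s
  obtain ⟨v, hvt, hMv⟩ := cs.exists_adj_of_coxeterNumber hCox t
  have hut : u ≠ t := by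
    rintro rfl
    lia
  have hvs : v ≠ s := by
    rintro rfl
    lia
  by_cases hMtu : M t u = 2
  · have hvu : v ≠ u := by
      rintro rfl
      lia
    exact ⟨[s, t, u, v], isReduced_of_comm hst hus hut hvs hvt hvu hMu hMv hMtu, by simp⟩
  · exact ⟨[s, t, u], isReduced_of_comm_of_adj hst hM hus hut hMu
      (cs.three_le_of_ne_two hut.symm hMtu), by simp⟩

end CoxeterSystem

namespace CoxeterSystem

variable {B W : Type*} [Group W] {M : CoxeterMatrix B} (cs : CoxeterSystem M W)
  {w₀ : W} (hw₀ : ∀ w : W, cs.length w ≤ cs.length w₀)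
include hw₀

theorem length_longest_mul_add_length (w : W) :
    cs.length (w₀ * w) + cs.length w = cs.length w₀ := by
  obtain ⟨ω, hω, rfl⟩ := cs.exists_isReduced w
  rw [hω.eq]
  induction ω using List.reverseRecOn with
  | nil => simp
  | append_singleton ω i ih =>
    have hω' : cs.IsReduced ω := by simpa using hω.take ω.length
    have h1 := ih hω'
    have hasc : ¬ cs.IsRightDescent (cs.wordProd ω) i := by
      have := hω.eq
      rw [not_isRightDescent_iff, hω'.eq]
      simpa [wordProd_append] using this
    have href := (cs.isReflection_simple i).conj (cs.wordProd ω)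
    have hpar : cs.inversionParity w₀
        (cs.wordProd ω * cs.simple i * (cs.wordProd ω)⁻¹) ≠ 0 := by
      rw [Ne, href.inversionParity_eq_zero_iff, not_not]
      exact lt_of_le_of_ne (hw₀ _) (href.length_mul_left_ne w₀)
    have hdesc : cs.IsRightDescent (w₀ * cs.wordProd ω) i := by
      by_contra h
      rw [← inversionParity_simple_eq_zero_iff] at h hasc
      rw [inversionParity_mul, hasc, zero_add] at h
      exact hpar h
    rw [isRightDescent_iff] at hdesc
    rw [wordProd_append, wordProd_singleton, ← mul_assoc, List.length_append,
      List.length_singleton]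
    lia

theorem bruhatLE_longest_mul {ω ω' : List B} {w : W} (hred : cs.IsReduced (ω ++ ω'))
    (hω' : cs.wordProd ω' = w⁻¹) (hsub : ∃ ζ : List B, ζ.Sublist ω ∧ cs.wordProd ζ = w) :
    cs.bruhatLE w (w₀ * w) := by
  obtain ⟨ζ, hζ, hζw⟩ := hsub
  obtain ⟨α, hα, hαp⟩ := cs.exists_isReduced (w₀ * (cs.wordProd (ω ++ ω'))⁻¹)
  have hprod : cs.wordProd (α ++ ω) = w₀ * w := by
    rw [wordProd_append, ← hαp, wordProd_append, hω']
    group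
  have h1 := cs.length_longest_mul_add_length hw₀ (cs.wordProd (ω ++ ω'))⁻¹
  have h2 := cs.length_longest_mul_add_length hw₀ w
  have hω'red : cs.length w = ω'.length := by
    have : cs.IsReduced ω' := by simpa using hred.drop ω.length
    rw [← this.eq, hω', length_inv]
  rw [hαp, hα.eq, length_inv, hred.eq, List.length_append] at h1
  refine ⟨α ++ ω, ?_, hprod, ζ, hζ.trans (List.sublist_append_right α ω), hζw⟩
  rw [IsReduced, hprod, List.length_append]
  lia

end CoxeterSystem

/-- Let `(W, S)` be a finite Coxeter system, each of whose irreducible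
factors has Coxeter number at least `5` (the Coxeter number of an irreducible component is
the order of the product of all the simple reflections of that component, taken in any
order).  Then every fat ideal `I` of the Bruhat order on `W` contains every element of
length at most `2`. -/
theorem fat_ideal_contains_length_le_two {B W : Type*} [Group W] [Finite W] [Finite B]
    {M : CoxeterMatrix B} (cs : CoxeterSystem M W)
    (hCox : ∀ i : B, ∀ l : List B, l.Nodup →
      (∀ j : B, j ∈ l ↔ M.SameComponent i j) → 5 ≤ orderOf (cs.wordProd l))
    (w₀ : W) (hw₀max : ∀ w : W, cs.length w ≤ cs.length w₀)
    (hw₀uniq : ∀ w : W, cs.length w = cs.length w₀ → w = w₀)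
    (I : Set W)
    (hIdeal : ∀ x y : W, cs.bruhatLE x y → y ∈ I → x ∈ I)
    (hFat : (fun w => w₀ * w) '' Iᶜ ⊆ I) :
    ∀ w : W, cs.length w ≤ 2 → w ∈ I := by
  intro w hw
  by_contra hwI
  have hw₀w : w₀ * w ∈ I := hFat ⟨w, hwI, rfl⟩
  refine hwI (hIdeal w (w₀ * w) ?_ hw₀w)
  obtain ⟨ω, hω, rfl⟩ := cs.exists_isReduced w
  rw [hω.eq] at hw
  match ω, hω, hw with
  | [], hω, _ =>
    exact cs.bruhatLE_longest_mul hw₀max (ω := []) (ω' := []) hω (by simp) ⟨[], by simp, rfl⟩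
  | [s], _, _ =>
    obtain ⟨t, hts, hM⟩ := cs.exists_adj_of_coxeterNumber hCox s
    exact cs.bruhatLE_longest_mul hw₀max (ω := [s, t]) (ω' := [s])
      (CoxeterSystem.isReduced_of_adj hts.symm hM) (by simp) ⟨[s], by simp, rfl⟩
  | [s, t], hω, _ =>
    have hst : s ≠ t := by
      rintro rfl
      have := hω.eq
      simp [CoxeterSystem.wordProd_cons] at this
    obtain ⟨ζ, hred, hsub⟩ := cs.exists_isReduced_of_ne hCox hst
    exact cs.bruhatLE_longest_mul hw₀max hred (by simp [CoxeterSystem.wordProd_cons])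
      ⟨_, hsub, rfl⟩
end

section
/- Let (W,S) be a finite Coxeter system which is a direct product of irreducible finite Coxeter systems, each of whose Coxeter numbers is at least 5. Then for any two simple reflections s, t in S, the element st is small, i.e., st <= w_0 st in the Bruhat order, where w_0 is the longest element of W. -/
/-! ### The geometric representation of a Coxeter group -/

namespace CoxeterMatrix

variable {B : Type*} (M : CoxeterMatrix B)

/-- The number `2 cos (π / M i j)`, read as `2` when `M i j = 0` (that is, infinite). -/
noncomputable def cosCoeff (i j : B) : ℝ := 2 * Real.cos (Real.pi / M i j)

/-- The linear functional sending the simple root `α j` to `cosCoeff i j`. -/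
noncomputable def coroot (i : B) : (B →₀ ℝ) →ₗ[ℝ] ℝ := Finsupp.linearCombination ℝ (M.cosCoeff i)

/-- The reflection in the simple root `α i = Finsupp.single i 1`. -/
noncomputable def reflection (i : B) : Module.End ℝ (B →₀ ℝ) :=
  LinearMap.id + (M.coroot i).smulRight (Finsupp.single i 1)

theorem cosCoeff_comm (i j : B) : M.cosCoeff i j = M.cosCoeff j i := by
  rw [cosCoeff, cosCoeff, M.symmetric]

@[simp]
theorem cosCoeff_self (i : B) : M.cosCoeff i i = -2 := by
  simp [cosCoeff]

theorem cosCoeff_eq_zero {i j : B} (h : M i j = 2) : M.cosCoeff i j = 0 := by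
  simp [cosCoeff, h]

theorem cosCoeff_eq_one {i j : B} (h : M i j = 3) : M.cosCoeff i j = 1 := by
  simp [cosCoeff, h]

theorem two_le_of_ne {i j : B} (hij : i ≠ j) (h : M i j ≠ 0) : 2 ≤ M i j := by
  have := M.off_diagonal i j hij
  lia

theorem one_lt_cosCoeff {i j : B} (hij : i ≠ j) (h2 : M i j ≠ 2) (h3 : M i j ≠ 3) :
    1 < M.cosCoeff i j := by
  by_cases h0 : M i j = 0
  · simp [cosCoeff, h0]
  have h4 : 4 ≤ M i j := by
    have := M.two_le_of_ne hij h0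
    lia
  have h4' : (4 : ℝ) ≤ M i j := mod_cast h4
  have key : Real.cos (Real.pi / 3) < Real.cos (Real.pi / M i j) := by
    apply Real.cos_lt_cos_of_nonneg_of_le_pi (by positivity) (by linarith [Real.pi_pos])
    apply div_lt_div_of_pos_left Real.pi_pos <;> linarith
  rw [Real.cos_pi_div_three] at key
  rw [cosCoeff]
  linarith

theorem cosCoeff_pos {i j : B} (hij : i ≠ j) (h2 : M i j ≠ 2) : 0 < M.cosCoeff i j := by
  by_cases h3 : M i j = 3
  · simp [M.cosCoeff_eq_one h3]
  · linarith [M.one_lt_cosCoeff hij h2 h3]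

theorem cosCoeff_nonneg {i j : B} (hij : i ≠ j) : 0 ≤ M.cosCoeff i j := by
  by_cases h2 : M i j = 2
  · exact (M.cosCoeff_eq_zero h2).ge
  · exact (M.cosCoeff_pos hij h2).le

@[simp]
theorem coroot_single (i j : B) (c : ℝ) :
    M.coroot i (Finsupp.single j c) = c * M.cosCoeff i j := by
  simp [coroot]

theorem reflection_apply (i : B) (v : B →₀ ℝ) :
    M.reflection i v = v + M.coroot i v • Finsupp.single i 1 := by
  simp [reflection]

@[simp]
theorem reflection_single (i j : B) (c : ℝ) :
    M.reflection i (Finsupp.single j c) =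
      Finsupp.single j c + Finsupp.single i (c * M.cosCoeff i j) := by
  simp [reflection_apply]

theorem reflection_apply_of_ne {i b : B} (h : b ≠ i) (v : B →₀ ℝ) :
    M.reflection i v b = v b := by
  simp [reflection_apply, h.symm]

theorem reflection_mul_self (i : B) : M.reflection i * M.reflection i = 1 := by
  ext1 j
  ext1
  simp only [LinearMap.comp_apply, Finsupp.lsingle_apply, Module.End.mul_apply, reflection_single,
    map_add, cosCoeff_self, Module.End.one_apply, one_mul, add_assoc, ← Finsupp.single_add]
  ring_nf
  simp

/-- Ratios `sin (k π / m) / sin (π / m)`, with `m = M i j`; they are the coefficients of the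
roots in the plane spanned by `α i` and `α j`. -/
theorem exists_dihedral_coeff {i j : B} (hij : i ≠ j) :
    ∃ U : ℕ → ℝ, U 0 = 0 ∧ U 1 = 1 ∧ (∀ k, U (k + 2) = M.cosCoeff i j * U (k + 1) - U k) ∧
      (∀ k, (M i j ≠ 0 → k ≤ M i j) → 0 ≤ U k) ∧
      ∀ n, M i j = n + 1 → U (2 * n + 1) = -1 ∧ U (2 * n + 2) = 0 := by
  by_cases h0 : M i j = 0
  · refine ⟨fun k => k, by simp, by simp, fun k => ?_, fun k _ => by positivity, by lia⟩
    simp only [cosCoeff, h0]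
    push_cast
    simp
    ring
  have hm : (2 : ℝ) ≤ M i j := mod_cast M.two_le_of_ne hij h0
  have hpi : (M i j : ℝ) * (Real.pi / M i j) = Real.pi := by field_simp
  set θ := Real.pi / M i j with hθ
  have hθ0 : 0 < θ := by positivity
  have hsin : 0 < Real.sin θ := by
    apply Real.sin_pos_of_pos_of_lt_pi hθ0
    nlinarith
  refine ⟨fun k => Real.sin (k * θ) / Real.sin θ, by simp, by simp [hsin.ne'], fun k => ?_,
    fun k hk => ?_, fun n hn => ?_⟩
  · have e1 : ((k + 2 : ℕ) : ℝ) * θ = (k + 1 : ℕ) * θ + θ := by push_cast; ring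
    have e2 : (k : ℝ) * θ = (k + 1 : ℕ) * θ - θ := by push_cast; ring
    simp only [cosCoeff, ← hθ]
    rw [e1, e2, Real.sin_add, Real.sin_sub]
    ring
  · apply div_nonneg _ hsin.le
    apply Real.sin_nonneg_of_nonneg_of_le_pi (by positivity)
    have : (k : ℝ) ≤ M i j := mod_cast hk h0
    nlinarith
  · rw [hn] at hpi
    push_cast at hpi
    constructor
    · have : ((2 * n + 1 : ℕ) : ℝ) * θ = -θ + 2 * Real.pi := by
        push_cast
        linear_combination 2 * hpi
      simp only [this, Real.sin_add_two_pi, Real.sin_neg, neg_div, div_self hsin.ne']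
    · have : ((2 * n + 2 : ℕ) : ℝ) * θ = 2 * Real.pi := by
        push_cast
        linear_combination 2 * hpi
      simp only [this, Real.sin_two_pi, zero_div]

theorem cosCoeff_sq_ne_four {i j : B} (hij : i ≠ j) (h : M i j ≠ 0) :
    4 - M.cosCoeff i j ^ 2 ≠ 0 := by
  have hm : (2 : ℝ) ≤ M i j := mod_cast M.two_le_of_ne hij h
  have hsin : 0 < Real.sin (Real.pi / M i j) := by
    apply Real.sin_pos_of_pos_of_lt_pi (by positivity)
    exact div_lt_self Real.pi_pos (by linarith)
  have := Real.sin_sq_add_cos_sq (Real.pi / M i j)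
  have : 4 - M.cosCoeff i j ^ 2 = 4 * Real.sin (Real.pi / M i j) ^ 2 := by
    rw [cosCoeff]
    linear_combination -4 * this
  rw [this]
  positivity

theorem isLiftable_reflection : M.IsLiftable M.reflection := by
  intro i j
  by_cases hij : i = j
  · subst hij
    simp [reflection_mul_self]
  by_cases h0 : M i j = 0
  · simp [h0]
  obtain ⟨n, hn⟩ := Nat.exists_eq_succ_of_ne_zero h0
  obtain ⟨U, U0, U1, Urec, -, Uend⟩ := M.exists_dihedral_coeff hij
  obtain ⟨Ua, Ub⟩ := Uend n hn
  set c := M.cosCoeff i j with hc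
  have hc' : M.cosCoeff j i = c := M.cosCoeff_comm j i
  set T := M.reflection i * M.reflection j with hT
  have Ti : T (Finsupp.single i 1) =
      (c ^ 2 - 1) • Finsupp.single i 1 + c • Finsupp.single j 1 := by
    simp only [hT, Module.End.mul_apply, reflection_apply, map_add, map_smul, coroot_single,
      cosCoeff_self, hc', ← hc]
    module
  have Tj : T (Finsupp.single j 1) = (-c) • Finsupp.single i 1 - Finsupp.single j 1 := by
    simp only [hT, Module.End.mul_apply, reflection_apply, map_add, map_smul, coroot_single,
      cosCoeff_self, ← hc]
    module
  have powi : ∀ k, (T ^ k) (Finsupp.single i 1) =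
      U (2 * k + 1) • Finsupp.single i 1 + U (2 * k) • Finsupp.single j 1 := by
    intro k
    induction k with
    | zero => simp [U0, U1]
    | succ k ih =>
      rw [pow_succ', Module.End.mul_apply, ih, map_add, map_smul, map_smul, Ti, Tj]
      rw [show 2 * (k + 1) + 1 = 2 * k + 1 + 2 by ring, show 2 * (k + 1) = 2 * k + 2 by ring,
        Urec (2 * k + 1), Urec (2 * k)]
      module
  have powj : ∀ k, (T ^ (k + 1)) (Finsupp.single j 1) =
      (-U (2 * k + 2)) • Finsupp.single i 1 - U (2 * k + 1) • Finsupp.single j 1 := by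
    intro k
    induction k with
    | zero => simp [U0, U1, Urec 0, Tj]
    | succ k ih =>
      rw [pow_succ', Module.End.mul_apply, ih, map_sub, map_smul, map_smul, Ti, Tj]
      rw [show 2 * (k + 1) + 2 = 2 * k + 2 + 2 by ring, show 2 * (k + 1) + 1 = 2 * k + 1 + 2 by ring,
        Urec (2 * k + 2), show 2 * k + 2 + 1 = 2 * k + 1 + 2 by ring, Urec (2 * k + 1)]
      module
  have fixi : (T ^ (n + 1)) (Finsupp.single i 1) = Finsupp.single i 1 := by
    rw [powi, show 2 * (n + 1) + 1 = 2 * n + 1 + 2 by ring, Urec,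
      show 2 * (n + 1) = 2 * n + 1 + 1 by ring, Ub, Ua]
    simp
  have fixj : (T ^ (n + 1)) (Finsupp.single j 1) = Finsupp.single j 1 := by
    rw [powj, Ub, Ua]
    simp
  have hD := M.cosCoeff_sq_ne_four hij h0
  rw [← hc] at hD
  rw [hn, Nat.succ_eq_add_one]
  refine LinearMap.ext fun v => ?_
  set a := -(2 * M.coroot i v + c * M.coroot j v) / (4 - c ^ 2) with ha
  set b := -(c * M.coroot i v + 2 * M.coroot j v) / (4 - c ^ 2) with hb
  set u := v - (a • Finsupp.single i 1 + b • Finsupp.single j 1) with hu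
  have ui : M.coroot i u = 0 := by
    simp only [hu, ha, hb, map_sub, map_add, map_smul, coroot_single, smul_eq_mul, cosCoeff_self,
      ← hc]
    field_simp
    ring
  have uj : M.coroot j u = 0 := by
    simp only [hu, ha, hb, map_sub, map_add, map_smul, coroot_single, smul_eq_mul, cosCoeff_self,
      hc']
    field_simp
    ring
  have Tu : T u = u := by
    simp [hT, reflection_apply, ui, uj]
  have powu : ∀ k, (T ^ k) u = u := by
    intro k
    induction k with
    | zero => simp
    | succ k ih => rw [pow_succ', Module.End.mul_apply, ih, Tu]
  have hv : v = u + (a • Finsupp.single i 1 + b • Finsupp.single j 1) := by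
    rw [hu, sub_add_cancel]
  rw [hv, map_add, map_add, map_smul, map_smul, powu, fixi, fixj, Module.End.one_apply]

end CoxeterMatrix

namespace CoxeterSystem

variable {B W : Type*} [Group W] {M : CoxeterMatrix B} (cs : CoxeterSystem M W)

/-- The geometric representation, in which every simple reflection acts as the reflection in
the corresponding simple root. -/
noncomputable def geometricRep : W →* Module.End ℝ (B →₀ ℝ) :=
  cs.lift ⟨M.reflection, M.isLiftable_reflection⟩

@[simp]
theorem geometricRep_simple (i : B) : cs.geometricRep (cs.simple i) = M.reflection i :=
  cs.lift_apply_simple _ _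

/-- The root obtained by applying `w` to the simple root of index `i`. -/
noncomputable def root (w : W) (i : B) : B →₀ ℝ := cs.geometricRep w (Finsupp.single i 1)

theorem root_mul_simple (w : W) (i j : B) :
    cs.root (w * cs.simple j) i = cs.root w i + M.cosCoeff j i • cs.root w j := by
  simp only [root, map_mul, geometricRep_simple, Module.End.mul_apply, M.reflection_apply,
    M.coroot_single, one_mul, map_add, map_smul]

theorem root_mul_simple_self (w : W) (i : B) : cs.root (w * cs.simple i) i = -cs.root w i := by
  rw [root_mul_simple, CoxeterMatrix.cosCoeff_self]
  module

theorem root_ne_zero (w : W) (i : B) : cs.root w i ≠ 0 := by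
  intro h
  have h' := congrArg (cs.geometricRep w⁻¹) h
  rw [root, ← Module.End.mul_apply, ← map_mul, inv_mul_cancel, map_one, map_zero] at h'
  simp at h'

theorem root_wordProd_cons_of_ne {a b : B} (h : b ≠ a) (ω : List B) (i : B) :
    cs.root (cs.wordProd (a :: ω)) i b = cs.root (cs.wordProd ω) i b := by
  simp [root, wordProd_cons, CoxeterMatrix.reflection_apply_of_ne M h]

theorem root_wordProd_of_notMem {b : B} {ω : List B} (h : b ∉ ω) (i : B) :
    cs.root (cs.wordProd ω) i b = Finsupp.single i 1 b := by
  induction ω with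
  | nil => simp [root]
  | cons a ω ih =>
    rw [List.mem_cons, not_or] at h
    rw [root_wordProd_cons_of_ne cs h.1, ih h.2]

theorem root_mul_alternatingWord (w : W) {U : ℕ → ℝ} {i j : B} (U0 : U 0 = 0) (U1 : U 1 = 1)
    (Urec : ∀ k, U (k + 2) = M.cosCoeff i j * U (k + 1) - U k) (k : ℕ) :
    cs.root (w * cs.wordProd (alternatingWord i j k)) i =
      U (k + 1) • cs.root w (if Even k then i else j) + U k • cs.root w (if Even k then j else i) := by
  induction k using Nat.strong_induction_on generalizing i j with
  | _ k ih =>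
    match k with
    | 0 => simp [alternatingWord, U0, U1]
    | 1 =>
      simp only [alternatingWord, List.concat_eq_append, List.nil_append, wordProd_singleton]
      rw [root_mul_simple, Urec 0, U0, U1, M.cosCoeff_comm j i]
      simp
      module
    | k + 2 =>
      have Urec' : ∀ k, U (k + 2) = M.cosCoeff j i * U (k + 1) - U k := by
        simpa only [M.cosCoeff_comm j i] using Urec
      have e1 := ih k (by lia) Urec
      have e2 := ih (k + 1) (by lia) Urec'
      have e3 : cs.root (w * cs.wordProd (alternatingWord j i (k + 1))) i =
          -cs.root (w * cs.wordProd (alternatingWord i j k)) i := by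
        rw [alternatingWord_succ, wordProd_concat, ← mul_assoc, root_mul_simple_self]
      rw [alternatingWord_succ, wordProd_concat, ← mul_assoc, root_mul_simple, e2, e3, e1,
        M.cosCoeff_comm j i, Urec (k + 1), Urec k]
      by_cases hk : Even k
      · simp [hk, parity_simps]
        module
      · simp [hk, parity_simps]
        module

theorem root_mul_alternatingWord_nonneg {w : W} {i j : B} (hij : i ≠ j)
    (hi : 0 ≤ cs.root w i) (hj : 0 ≤ cs.root w j) {k : ℕ} (hk : M i j ≠ 0 → k < M i j) :
    0 ≤ cs.root (w * cs.wordProd (alternatingWord i j k)) i := by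
  obtain ⟨U, U0, U1, Urec, Unonneg, -⟩ := M.exists_dihedral_coeff hij
  rw [cs.root_mul_alternatingWord w U0 U1 Urec]
  have h1 := Unonneg (k + 1) hk
  have h2 := Unonneg k fun h => (hk h).le
  intro b
  have hi' := hi b
  have hj' := hj b
  simp only [Finsupp.coe_zero, Pi.zero_apply] at hi' hj'
  split_ifs <;> simp <;> positivity

/-- A root `w α i` is nonnegative when `i` is not a right descent of `w`. -/
theorem root_nonneg_of_not_isRightDescent {w : W} {i : B} (h : ¬cs.IsRightDescent w i) :
    0 ≤ cs.root w i := by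
  induction hn : cs.length w using Nat.strong_induction_on generalizing w i with
  | _ n ih =>
    subst hn
    by_cases hw : w = 1
    · subst hw
      simp [root]
    obtain ⟨j, hj⟩ := cs.exists_rightDescent_of_ne_one hw
    have hij : i ≠ j := by
      rintro rfl
      exact h hj
    let P : ℕ → Prop := fun k =>
      ∃ v, w = v * cs.wordProd (alternatingWord i j k) ∧ cs.length w = cs.length v + k
    have hdown : ∀ k, P (k + 1) → P k := by
      rintro k ⟨v, hv, hl⟩
      rw [alternatingWord_succ', wordProd_cons, ← mul_assoc] at hv
      refine ⟨_, hv, le_antisymm ?_ ?_⟩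
      · calc
          cs.length w ≤ _ := hv ▸ cs.length_mul_le _ _
          _ ≤ _ := by
            gcongr
            simpa using cs.length_wordProd_le (alternatingWord i j k)
      · have := cs.length_mul_le v (cs.simple (if Even k then j else i))
        rw [length_simple] at this
        lia
    have hdowns : ∀ d k, P (k + d) → P k := by
      intro d
      induction d with
      | zero => exact fun _ => id
      | succ d ihd => exact fun k hk => ihd k (hdown _ hk)
    have hP1 : P 1 := by
      refine ⟨w * cs.simple j, by simp [alternatingWord], ?_⟩
      exact (cs.isRightDescent_iff.mp hj).symm
    have hlt : ∀ k, P k → M i j ≠ 0 → k < M i j := by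
      intro k hk h0
      by_contra! hle
      have hPm : P (M i j) := by
        rw [← Nat.add_sub_cancel' hle] at hk
        exact hdowns _ _ hk
      obtain ⟨v, hv, hl⟩ := hPm
      obtain ⟨m, hm⟩ := Nat.exists_eq_succ_of_ne_zero h0
      have hb := cs.wordProd_braidWord_eq i j
      rw [braidWord, braidWord, ← M.symmetric i j, hm, Nat.succ_eq_add_one,
        alternatingWord_succ j i, wordProd_concat] at hb
      rw [hm, Nat.succ_eq_add_one, hb, ← mul_assoc] at hv
      apply h
      rw [IsRightDescent, hv, simple_mul_simple_cancel_right, ← hv]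
      have h1 := cs.length_mul_le v (cs.wordProd (alternatingWord i j m))
      have h2 := cs.length_wordProd_le (alternatingWord i j m)
      rw [length_alternatingWord] at h2
      lia
    have hbdd : ∀ k, P k → k ≤ cs.length w := by
      rintro k ⟨v, -, hl⟩
      lia
    classical
    set k := Nat.findGreatest P (cs.length w) with hkdef
    have hPk : P k := Nat.findGreatest_spec (hbdd 1 hP1) hP1
    have hk1 : 1 ≤ k := Nat.le_findGreatest (hbdd 1 hP1) hP1
    have hmax : ¬P (k + 1) := fun hP => by
      have := Nat.le_findGreatest (hbdd _ hP) hP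
      lia
    obtain ⟨l, hl⟩ := Nat.exists_eq_succ_of_ne_zero (show k ≠ 0 by lia)
    have hkM := hlt k hPk
    obtain ⟨v, hv, hlen⟩ := hPk
    have hda : ¬cs.IsRightDescent v (if Even k then j else i) := by
      intro hd
      refine hmax ⟨v * cs.simple (if Even k then j else i), ?_, ?_⟩
      · rw [alternatingWord_succ', wordProd_cons, ← mul_assoc, simple_mul_simple_cancel_right, ← hv]
      · rw [isRightDescent_iff] at hd
        lia
    have hdb : ¬cs.IsRightDescent v (if Even k then i else j) := by
      intro hd
      rw [isRightDescent_iff] at hd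
      have hev : (if Even l then j else i) = if Even k then i else j := by
        rw [hl]
        by_cases hl : Even l <;> simp [hl, parity_simps]
      rw [hl, Nat.succ_eq_add_one, alternatingWord_succ', wordProd_cons, ← mul_assoc, hev] at hv
      have h1 := cs.length_mul_le (v * cs.simple (if Even k then i else j))
        (cs.wordProd (alternatingWord i j l))
      have h2 := cs.length_wordProd_le (alternatingWord i j l)
      rw [length_alternatingWord] at h2
      rw [← hv] at h1
      lia
    have hvlt : cs.length v < cs.length w := by lia
    have ra := ih _ hvlt hda rfl
    have rb := ih _ hvlt hdb rfl
    rw [hv]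
    split_ifs at ra rb
    · exact cs.root_mul_alternatingWord_nonneg hij rb ra hkM
    · exact cs.root_mul_alternatingWord_nonneg hij ra rb hkM

theorem root_nonpos_of_isRightDescent {w : W} {i : B} (h : cs.IsRightDescent w i) :
    cs.root w i ≤ 0 := by
  have := cs.root_nonneg_of_not_isRightDescent (cs.isRightDescent_iff_not_isRightDescent_mul.mp h)
  rw [root_mul_simple_self] at this
  intro b
  simpa using this b

theorem not_isRightDescent_of_root_pos {w : W} {i : B} (b : B) (h : 0 < cs.root w i b) :
    ¬cs.IsRightDescent w i := fun hd =>
  (cs.root_nonpos_of_isRightDescent hd b).not_gt h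

theorem not_isRightDescent_iff_root_nonneg {w : W} {i : B} :
    ¬cs.IsRightDescent w i ↔ 0 ≤ cs.root w i :=
  ⟨cs.root_nonneg_of_not_isRightDescent, fun h hd =>
    cs.root_ne_zero w i (le_antisymm (cs.root_nonpos_of_isRightDescent hd) h)⟩

theorem isRightDescent_iff_root_nonpos {w : W} {i : B} :
    cs.IsRightDescent w i ↔ cs.root w i ≤ 0 := by
  refine ⟨cs.root_nonpos_of_isRightDescent, fun h => ?_⟩
  by_contra hd
  exact cs.root_ne_zero w i (le_antisymm h (cs.root_nonneg_of_not_isRightDescent hd))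

theorem isReduced_nil : cs.IsReduced [] := by
  simp [IsReduced]

theorem IsReduced.append_singleton {cs : CoxeterSystem M W} {ω : List B} {i : B}
    (hω : cs.IsReduced ω) (h : ¬cs.IsRightDescent (cs.wordProd ω) i) :
    cs.IsReduced (ω ++ [i]) := by
  rw [not_isRightDescent_iff, hω.eq] at h
  simpa [IsReduced, wordProd_append] using h

theorem IsReduced.append_of_notMem {cs : CoxeterSystem M W} {ω : List B} {i : B}
    (hω : cs.IsReduced ω) (h : i ∉ ω) : cs.IsReduced (ω ++ [i]) := by
  refine hω.append_singleton (cs.not_isRightDescent_of_root_pos i ?_)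
  simp [cs.root_wordProd_of_notMem h]

theorem isReduced_of_nodup {ω : List B} (h : ω.Nodup) : cs.IsReduced ω := by
  induction ω using List.reverseRecOn with
  | nil => exact cs.isReduced_nil
  | append_singleton ω i ih =>
    rw [List.nodup_append] at h
    exact (ih h.1).append_of_notMem fun hi => h.2.2 i hi i (by simp) rfl

theorem IsReduced.append_alternatingWord {cs : CoxeterSystem M W} {ω : List B} {i j : B}
    (hij : i ≠ j) (hω : cs.IsReduced ω) (hi : ¬cs.IsRightDescent (cs.wordProd ω) i)
    (hj : ¬cs.IsRightDescent (cs.wordProd ω) j) {k : ℕ} (hk : M i j ≠ 0 → k ≤ M i j) :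
    cs.IsReduced (ω ++ alternatingWord i j k) := by
  induction k generalizing i j with
  | zero => simpa [alternatingWord] using hω
  | succ k ih =>
    have hk' : M j i ≠ 0 → k < M j i := by
      rw [M.symmetric j i]
      exact hk
    rw [alternatingWord_succ, List.concat_eq_append, ← List.append_assoc]
    refine (ih hij.symm hj hi fun h => (hk' h).le).append_singleton ?_
    rw [not_isRightDescent_iff_root_nonneg] at hi hj ⊢
    rw [wordProd_append]
    exact cs.root_mul_alternatingWord_nonneg hij.symm hj hi hk'

theorem length_mul_of_forall_isRightDescent {w : W} (hw : ∀ i, cs.IsRightDescent w i) (u : W) :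
    cs.length (w * u) + cs.length u = cs.length w := by
  obtain ⟨ω, hω, rfl⟩ := cs.exists_isReduced u
  induction ω using List.reverseRecOn with
  | nil => simp
  | append_singleton ω i ih =>
    have hω' : cs.IsReduced ω := by simpa using hω.take ω.length
    have hnd : ¬cs.IsRightDescent (cs.wordProd ω) i := by
      rw [not_isRightDescent_iff, hω'.eq]
      simpa [wordProd_append] using hω.eq
    have hroot := cs.root_nonneg_of_not_isRightDescent hnd
    have hd : cs.IsRightDescent (w * cs.wordProd ω) i := by
      rw [isRightDescent_iff_root_nonpos, root, map_mul, Module.End.mul_apply]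
      change cs.geometricRep w (cs.root (cs.wordProd ω) i) ≤ 0
      rw [← Finsupp.sum_single (cs.root (cs.wordProd ω) i), Finsupp.sum, map_sum]
      refine Finset.sum_nonpos fun j _ b => ?_
      have h1 := hroot j
      have h2 := cs.root_nonpos_of_isRightDescent (hw j) b
      rw [← mul_one (cs.root (cs.wordProd ω) i j), ← smul_eq_mul, ← Finsupp.smul_single, map_smul]
      exact mul_nonpos_of_nonneg_of_nonpos h1 h2
    have ih' := ih hω'
    rw [isRightDescent_iff, mul_assoc] at hd
    have h1 := hω.eq
    have h2 := hω'.eq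
    rw [List.length_append, List.length_singleton] at h1
    rw [h1, wordProd_append, wordProd_singleton]
    lia

theorem exists_isReduced_append_of_longest {w₀ : W} (h : ∀ w, cs.length w ≤ cs.length w₀)
    {ω : List B} (hω : cs.IsReduced ω) :
    ∃ ν, cs.IsReduced (ν ++ ω) ∧ cs.wordProd (ν ++ ω) = w₀ := by
  have hd : ∀ i, cs.IsRightDescent w₀ i := fun i =>
    (h _).lt_of_ne (cs.length_mul_simple_ne w₀ i)
  have hl := cs.length_mul_of_forall_isRightDescent hd (cs.wordProd ω)⁻¹
  obtain ⟨ν, hν, hprod⟩ := cs.exists_isReduced (w₀ * (cs.wordProd ω)⁻¹)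
  have hw : cs.wordProd (ν ++ ω) = w₀ := by
    rw [wordProd_append, ← hprod, inv_mul_cancel_right]
  refine ⟨ν, ?_, hw⟩
  rw [IsReduced, hw, ← hl, length_inv, hprod, hν.eq, hω.eq, List.length_append]

/-- A criterion for `s t ≤ w₀ s t`: it suffices to find one reduced word that ends in `t s` and
has `s t` as a subword of the preceding part. -/
theorem bruhatLE_longest_mul_s4 {w₀ : W} (h : ∀ w, cs.length w ≤ cs.length w₀) {i j : B}
    {ω : List B} (hω : cs.IsReduced (ω ++ [j, i])) (hsub : [i, j].Sublist ω) :
    cs.bruhatLE (cs.simple i * cs.simple j) (w₀ * (cs.simple i * cs.simple j)) := by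
  obtain ⟨ν, hν, rfl⟩ := cs.exists_isReduced_append_of_longest h hω
  refine ⟨ν ++ ω, ?_, ?_, [i, j], hsub.trans (List.sublist_append_right ν ω), ?_⟩
  · rw [← List.append_assoc] at hν
    simpa only [List.take_left'] using hν.take (ν ++ ω).length
  · simp [wordProd_append, wordProd_cons, mul_assoc]
  · simp [wordProd_cons]

end CoxeterSystem

theorem CoxeterMatrix.SameComponent.mem_of_closed {B : Type*} {M : CoxeterMatrix B} {C : Set B}
    (hC : ∀ a ∈ C, ∀ b, a ≠ b → M a b ≠ 2 → b ∈ C) {i j : B} (h : M.SameComponent i j)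
    (hi : i ∈ C) : j ∈ C := by
  suffices ∀ a b, M.SameComponent a b → (a ∈ C ↔ b ∈ C) from (this i j h).1 hi
  intro a b hab
  induction hab with
  | rel a b h =>
    refine ⟨fun ha => hC a ha b h.1 h.2, fun hb => hC b hb a h.1.symm ?_⟩
    rw [M.symmetric]
    exact h.2
  | refl => rfl
  | symm _ _ _ ih => exact ih.symm
  | trans _ _ _ _ _ ih₁ ih₂ => exact ih₁.trans ih₂

theorem CoxeterMatrix.sameComponent_of_ne_two {B : Type*} {M : CoxeterMatrix B} {i j : B}
    (hij : i ≠ j) (h : M i j ≠ 2) : M.SameComponent i j :=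
  .rel _ _ ⟨hij, h⟩

/-- A Coxeter element of type `A₃` has order dividing `4`. -/
theorem pow_four_eq_one_of_braid {G : Type*} [Group G] {a b c : G} (ha : a * a = 1)
    (hb : b * b = 1) (hc : c * c = 1) (hab : a * b * a = b * a * b) (hac : a * c * a = c * a * c)
    (hbc : b * c = c * b) : (a * b * c) ^ 4 = 1 := by
  have h2 : (a * b * c) ^ 2 = a * c * a * b * a * c := calc
    (a * b * c) ^ 2 = a * (b * c) * (a * b) * c := by simp only [pow_two, mul_assoc]
    _ = a * c * (b * a * b) * c := by rw [hbc]; group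
    _ = a * c * a * b * a * c := by rw [← hab]; group
  calc
    (a * b * c) ^ 4 = ((a * b * c) ^ 2) ^ 2 := by rw [← pow_mul]
    _ = a * c * a * b * ((a * c * a) * c * a) * b * a * c := by
      rw [h2, pow_two]
      simp only [mul_assoc]
    _ = a * c * a * b * (c * a * (c * c) * a) * b * a * c := by rw [hac]; group
    _ = a * c * a * b * (c * (a * a)) * b * a * c := by rw [hc]; group
    _ = a * c * a * (b * c) * b * a * c := by rw [ha]; group
    _ = (a * c * a) * c * (b * b) * a * c := by rw [hbc]; group
    _ = c * a * (c * c) * (a * c) := by rw [hac, hb]; group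
    _ = c * (a * a) * c := by rw [hc]; group
    _ = 1 := by rw [ha, mul_one, hc]

namespace CoxeterSystem

variable {B W : Type*} [Group W] {M : CoxeterMatrix B} (cs : CoxeterSystem M W)

/-- `ω` is a reduced word for an element that is minimal in its coset of the parabolic subgroup
generated by `i` and `j`. -/
def IsReducedMinimal (ω : List B) (i j : B) : Prop :=
  cs.IsReduced ω ∧ ¬cs.IsRightDescent (cs.wordProd ω) i ∧ ¬cs.IsRightDescent (cs.wordProd ω) j

variable {cs}

theorem IsReducedMinimal.isReduced_append {ω : List B} {i j : B} (h : cs.IsReducedMinimal ω i j)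
    (hij : i ≠ j) {k : ℕ} (hk : M i j ≠ 0 → k ≤ M i j) :
    cs.IsReduced (ω ++ alternatingWord j i k) := by
  rw [M.symmetric] at hk
  exact h.1.append_alternatingWord hij.symm h.2.2 h.2.1 hk

variable (cs)

theorem isReducedMinimal_nil (i j : B) : cs.IsReducedMinimal [] i j :=
  ⟨cs.isReduced_nil, by simpa using cs.not_isRightDescent_one i,
    by simpa using cs.not_isRightDescent_one j⟩

theorem isReducedMinimal_pair {i j r : B} (hij : i ≠ j) (hri : r ≠ i) (hrj : r ≠ j)
    (h : M r i ≠ 2) : cs.IsReducedMinimal [i, r] i j := by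
  have hk := M.cosCoeff_pos hri h
  refine ⟨cs.isReduced_of_nodup (by simp [hri.symm]),
    cs.not_isRightDescent_of_root_pos r ?_, cs.not_isRightDescent_of_root_pos j ?_⟩
  · rw [cs.root_wordProd_cons_of_ne hri]
    simpa [root, hri] using hk
  · simp [cs.root_wordProd_of_notMem (b := j) (ω := [i, r]) (by simp [hij.symm, hrj.symm])]

theorem isReducedMinimal_triple {i j r : B} (hij : i ≠ j) (hri : r ≠ i) (hrj : r ≠ j)
    (h : M r j ≠ 2) (h' : M j i ≠ 2 ∨ M r i ≠ 2) : cs.IsReducedMinimal [i, j, r] i j := by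
  have hk := M.cosCoeff_pos hrj h
  refine ⟨cs.isReduced_of_nodup (by simp [hri.symm, hrj.symm, hij]), ?_,
    cs.not_isRightDescent_of_root_pos r ?_⟩
  · rcases h' with h' | h'
    · have h1 := M.cosCoeff_pos hij.symm h'
      have h2 := M.cosCoeff_nonneg hri
      refine cs.not_isRightDescent_of_root_pos j ?_
      rw [cs.root_wordProd_cons_of_ne hij.symm]
      simp [root, wordProd_cons, hrj, hij.symm]
      rw [M.cosCoeff_comm j r]
      positivity
    · refine cs.not_isRightDescent_of_root_pos r ?_
      rw [cs.root_wordProd_cons_of_ne hri, cs.root_wordProd_cons_of_ne hrj]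
      simpa [root, hri] using M.cosCoeff_pos hri h'
  · rw [cs.root_wordProd_cons_of_ne hri, cs.root_wordProd_cons_of_ne hrj]
    simpa [root, hrj] using hk

theorem isReducedMinimal_quadruple {i j r q : B} (hij : i ≠ j) (hri : r ≠ i) (hrj : r ≠ j)
    (hqi : q ≠ i) (hqj : q ≠ j) (hrq : r ≠ q) (hr : M r i ≠ 2) (hq : M q j ≠ 2) :
    cs.IsReducedMinimal [i, j, r, q] i j := by
  have hk := M.cosCoeff_pos hri hr
  have hl := M.cosCoeff_pos hqj hq
  have h1 := M.cosCoeff_nonneg hrq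
  have h2 := M.cosCoeff_nonneg hqi
  refine ⟨cs.isReduced_of_nodup (by simp [hri.symm, hrj.symm, hqi.symm, hqj.symm, hij, hrq]),
    cs.not_isRightDescent_of_root_pos r ?_, cs.not_isRightDescent_of_root_pos q ?_⟩
  · rw [cs.root_wordProd_cons_of_ne hri, cs.root_wordProd_cons_of_ne hrj]
    simp [root, wordProd_cons, hri, hrq]
    positivity
  · rw [cs.root_wordProd_cons_of_ne hqi, cs.root_wordProd_cons_of_ne hqj,
      cs.root_wordProd_cons_of_ne hrq.symm]
    simpa [root, hqj] using hl

theorem isReduced_star {i j r : B} (hij : i ≠ j) (hri : r ≠ i) (hrj : r ≠ j) (h : M r i ≠ 2) :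
    cs.IsReduced [i, j, r, i] := by
  refine IsReduced.append_singleton (ω := [i, j, r])
    (cs.isReduced_of_nodup (by simp [hri.symm, hrj.symm, hij]))
    (cs.not_isRightDescent_of_root_pos r ?_)
  rw [cs.root_wordProd_cons_of_ne hri, cs.root_wordProd_cons_of_ne hrj]
  simpa [root, hri] using M.cosCoeff_pos hri h

theorem isReducedMinimal_star {i j r q : B} (hij : i ≠ j) (hri : r ≠ i) (hrj : r ≠ j)
    (hqi : q ≠ i) (hqj : q ≠ j) (hMij : M i j = 3) (hMri : M r i ≠ 2) (hMrj : M r j = 2)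
    (hMqi : M q i ≠ 2) (hMqj : M q j = 2) (hrq : q = r → M r i ≠ 3) :
    cs.IsReducedMinimal [i, j, r, i, q] i j := by
  have hk := M.cosCoeff_pos hri hMri
  have hl := M.cosCoeff_pos hqi hMqi
  have h0 := M.cosCoeff_eq_zero hMqj
  have h0' := M.cosCoeff_eq_zero hMrj
  have h1 := M.cosCoeff_eq_one hMij
  refine ⟨IsReduced.append_singleton (ω := [i, j, r, i])
    (cs.isReduced_star hij hri hrj hMri) ?_, ?_, cs.not_isRightDescent_of_root_pos r ?_⟩
  · by_cases hqr : q = r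
    · subst hqr
      have hk' := M.one_lt_cosCoeff hri hMri (hrq rfl)
      refine cs.not_isRightDescent_of_root_pos q ?_
      rw [cs.root_wordProd_cons_of_ne hri, cs.root_wordProd_cons_of_ne hrj]
      simp [root, wordProd_cons, hri, M.cosCoeff_comm i q]
      nlinarith
    · refine cs.not_isRightDescent_of_root_pos q ?_
      simp [cs.root_wordProd_of_notMem (b := q) (ω := [i, j, r, i]) (by simp [hqi, hqj, hqr])]
  · by_cases hqr : q = r
    · subst hqr
      have hk' := M.one_lt_cosCoeff hri hMri (hrq rfl)
      refine cs.not_isRightDescent_of_root_pos j ?_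
      rw [cs.root_wordProd_cons_of_ne hij.symm]
      simp [-Finsupp.single_mul, root, wordProd_cons, hij.symm, hrj.symm, h0,
        M.cosCoeff_comm j i, M.cosCoeff_comm i q, M.cosCoeff_comm j q, h1]
      nlinarith
    · refine cs.not_isRightDescent_of_root_pos q ?_
      rw [cs.root_wordProd_cons_of_ne hqi, cs.root_wordProd_cons_of_ne hqj,
        cs.root_wordProd_cons_of_ne hqr, cs.root_wordProd_cons_of_ne hqi]
      simpa [root, hqi] using hl
  · rw [cs.root_wordProd_cons_of_ne hri, cs.root_wordProd_cons_of_ne hrj]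
    simpa [root, wordProd_cons, hri, hrj, h0, h0', h1] using hk

theorem isReducedMinimal_path {i j r q : B} (hij : i ≠ j) (hri : r ≠ i) (hrj : r ≠ j)
    (hqi : q ≠ i) (hqj : q ≠ j) (hqr : q ≠ r) (hMij : M i j = 3) (hMri : M r i = 3)
    (hMrj : M r j = 2) (hMqi : M q i = 2) (hMqj : M q j = 2) (hMqr : M q r ≠ 2) :
    cs.IsReducedMinimal [i, j, r, i, q, r] i j := by
  have hMri' : M r i ≠ 2 := by lia
  have hk := M.cosCoeff_pos hqr hMqr
  have h0 := M.cosCoeff_eq_zero hMqj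
  have h0' := M.cosCoeff_eq_zero hMrj
  have h0'' := M.cosCoeff_eq_zero hMqi
  have h1 := M.cosCoeff_eq_one hMij
  have h1' := M.cosCoeff_eq_one hMri
  refine ⟨IsReduced.append_singleton (ω := [i, j, r, i, q])
    (IsReduced.append_of_notMem (ω := [i, j, r, i]) (cs.isReduced_star hij hri hrj hMri')
      (by simp [hqi, hqj, hqr])) (cs.not_isRightDescent_of_root_pos q ?_),
    cs.not_isRightDescent_of_root_pos q ?_, cs.not_isRightDescent_of_root_pos r ?_⟩
  · rw [cs.root_wordProd_cons_of_ne hqi, cs.root_wordProd_cons_of_ne hqj,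
      cs.root_wordProd_cons_of_ne hqr, cs.root_wordProd_cons_of_ne hqi]
    simpa [root, hqr] using hk
  · rw [cs.root_wordProd_cons_of_ne hqi, cs.root_wordProd_cons_of_ne hqj,
      cs.root_wordProd_cons_of_ne hqr, cs.root_wordProd_cons_of_ne hqi]
    simpa [root, wordProd_cons, hqr, hqi, h0'', h1'] using hk
  · rw [cs.root_wordProd_cons_of_ne hri, cs.root_wordProd_cons_of_ne hrj]
    simp [root, wordProd_cons, hri, hrj, h0, h0', h1, h1']

/-- If every irreducible component has a Coxeter element of order at least `5`, then a component
is never of type `A₁`. -/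
theorem exists_adjacent (hCox : ∀ i : B, ∀ l : List B, l.Nodup →
      (∀ j : B, j ∈ l ↔ M.SameComponent i j) → 5 ≤ orderOf (cs.wordProd l)) (i : B) :
    ∃ r, r ≠ i ∧ M r i ≠ 2 := by
  by_contra! h
  have h5 := hCox i [i] (by simp) fun j => by
    rw [List.mem_singleton]
    constructor
    · rintro rfl
      exact .refl _
    · refine fun hj => hj.mem_of_closed (C := {i}) ?_ rfl
      rintro a rfl b hab hM
      rw [M.symmetric] at hM
      exact absurd (h b hab.symm) hM
  have := orderOf_le_of_pow_eq_one (x := cs.wordProd [i]) (n := 2) (by simp) (by simp)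
  lia

/-- If every irreducible component has a Coxeter element of order at least `5`, then a component
is never of type `I₂(m)` with `m ≤ 4`. -/
theorem exists_adjacent_pair (hCox : ∀ i : B, ∀ l : List B, l.Nodup →
      (∀ j : B, j ∈ l ↔ M.SameComponent i j) → 5 ≤ orderOf (cs.wordProd l)) {i j : B}
    (hij : i ≠ j) (h2 : M i j ≠ 2) (h0 : M i j ≠ 0) (h4 : M i j ≤ 4) :
    ∃ r, r ≠ i ∧ r ≠ j ∧ (M r i ≠ 2 ∨ M r j ≠ 2) := by
  by_contra! h
  have h5 := hCox i [i, j] (by simp [hij]) fun k => by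
    rw [List.mem_pair]
    constructor
    · rintro (rfl | rfl)
      · exact .refl _
      · exact M.sameComponent_of_ne_two hij h2
    · refine fun hk => hk.mem_of_closed (C := {i, j}) ?_ (by simp)
      rintro a ha b hab hM
      by_contra hb
      simp only [Set.mem_insert_iff, Set.mem_singleton_iff, not_or] at ha hb
      obtain ⟨h1, h2⟩ := h b hb.1 hb.2
      rw [M.symmetric] at hM
      rcases ha with rfl | rfl <;> contradiction
  have := orderOf_le_of_pow_eq_one (x := cs.wordProd [i, j]) (n := M i j) (by lia)
    (by simp [wordProd_cons])
  lia

/-- If every irreducible component has a Coxeter element of order at least `5`, then a component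
is never of type `A₃`. -/
theorem exists_adjacent_triple (hCox : ∀ i : B, ∀ l : List B, l.Nodup →
      (∀ j : B, j ∈ l ↔ M.SameComponent i j) → 5 ≤ orderOf (cs.wordProd l)) {i j r : B}
    (hij : i ≠ j) (hri : r ≠ i) (hrj : r ≠ j) (hMij : M i j = 3) (hMri : M r i = 3)
    (hMrj : M r j = 2) :
    ∃ q, q ≠ i ∧ q ≠ j ∧ q ≠ r ∧ (M q i ≠ 2 ∨ M q j ≠ 2 ∨ M q r ≠ 2) := by
  by_contra! h
  have h5 := hCox i [i, j, r] (by simp [hij, hri.symm, hrj.symm]) fun k => by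
    simp only [List.mem_cons, List.not_mem_nil, or_false]
    constructor
    · rintro (rfl | rfl | rfl)
      · exact .refl _
      · exact M.sameComponent_of_ne_two hij (by lia)
      · exact M.sameComponent_of_ne_two hri.symm (by rw [M.symmetric]; lia)
    · refine fun hk => hk.mem_of_closed (C := {i, j, r}) ?_ (by simp)
      rintro a ha b hab hM
      by_contra hb
      simp only [Set.mem_insert_iff, Set.mem_singleton_iff, not_or] at ha hb
      obtain ⟨h1, h2, h3⟩ := h b hb.1 hb.2.1 hb.2.2
      rw [M.symmetric] at hM
      rcases ha with rfl | rfl | rfl <;> contradiction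
  have hij3 := cs.wordProd_braidWord_eq i j
  have hir3 := cs.wordProd_braidWord_eq i r
  have hjr2 := cs.wordProd_braidWord_eq j r
  rw [M.symmetric] at hMri hMrj
  simp only [braidWord, hMij, M.symmetric j i, hMri, M.symmetric r i, hMrj, M.symmetric r j,
    alternatingWord, List.concat_eq_append, List.nil_append, List.cons_append, wordProd_cons,
    wordProd_nil, mul_one, ← mul_assoc] at hij3 hir3 hjr2
  have := orderOf_le_of_pow_eq_one (x := cs.wordProd [i, j, r]) (n := 4) (by lia) (by
    simpa [wordProd_cons, mul_assoc] using pow_four_eq_one_of_braid (cs.simple_mul_simple_self i)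
      (cs.simple_mul_simple_self j) (cs.simple_mul_simple_self r) hij3.symm hir3.symm hjr2)
  lia

/-- If every irreducible component has a Coxeter element of order at least `5`, then for distinct
`s` and `t` there is a reduced word ending in `t s`, with `s t` as a subword of the rest. -/
theorem exists_isReduced_append_pair (hCox : ∀ i : B, ∀ l : List B, l.Nodup →
      (∀ j : B, j ∈ l ↔ M.SameComponent i j) → 5 ≤ orderOf (cs.wordProd l)) {i j : B}
    (hij : i ≠ j) : ∃ ω, cs.IsReduced (ω ++ [j, i]) ∧ [i, j].Sublist ω := by
  have hsub : ∀ ω : List B, [i, j].Sublist (i :: j :: ω) := fun ω =>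
    ((List.nil_sublist ω).cons_cons j).cons_cons i
  by_cases h2 : M i j = 2
  · have key : ∀ ω : List B, cs.IsReducedMinimal (i :: j :: ω) i j →
        ∃ ω, cs.IsReduced (ω ++ [j, i]) ∧ [i, j].Sublist ω := fun ω h =>
      ⟨_, h.isReduced_append hij (k := 2) (by lia), hsub ω⟩
    have hne : ∀ {a b c : B}, M a b = 2 → M c b ≠ 2 → c ≠ a := by
      rintro a b c h h' rfl
      exact h' h
    obtain ⟨r, hri, hr⟩ := cs.exists_adjacent hCox i
    obtain ⟨q, hqj, hq⟩ := cs.exists_adjacent hCox j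
    have hrj : r ≠ j := hne (M.symmetric i j ▸ h2) hr
    have hqi : q ≠ i := hne h2 hq
    by_cases hrq : r = q
    · subst hrq
      exact key _ (cs.isReducedMinimal_triple hij hri hrj hq (.inr hr))
    · exact key _ (cs.isReducedMinimal_quadruple hij hri hrj hqi hqj hrq hr hq)
  by_cases h3 : M i j = 3
  · have key : ∀ ω : List B, cs.IsReducedMinimal (i :: j :: ω) i j →
        ∃ ω, cs.IsReduced (ω ++ [j, i]) ∧ [i, j].Sublist ω := fun ω h =>
      ⟨(i :: j :: ω) ++ [i], by
        rw [List.append_assoc]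
        exact h.isReduced_append hij (k := 3) (by lia), (hsub ω).trans (List.sublist_append_left _ _)⟩
    by_cases hj : ∃ r, r ≠ i ∧ r ≠ j ∧ M r j ≠ 2
    · obtain ⟨r, hri, hrj, hr⟩ := hj
      exact key _ (cs.isReducedMinimal_triple hij hri hrj hr (.inl (M.symmetric i j ▸ h2)))
    push Not at hj
    obtain ⟨r, hri, hrj, hr⟩ := cs.exists_adjacent_pair hCox hij h2 (by lia) (by lia)
    have hMrj := hj r hri hrj
    have hMri : M r i ≠ 2 := hr.resolve_right (· hMrj)
    by_cases hr3 : M r i = 3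
    · obtain ⟨q, hqi, hqj, hqr, hq⟩ := cs.exists_adjacent_triple hCox hij hri hrj h3 hr3 hMrj
      have hMqj := hj q hqi hqj
      by_cases hMqi : M q i = 2
      · exact key _ (cs.isReducedMinimal_path hij hri hrj hqi hqj hqr h3 hr3 hMrj hMqi hMqj
          (by tauto))
      · exact key _ (cs.isReducedMinimal_star hij hri hrj hqi hqj h3 hMri hMrj hMqi hMqj
          fun h => absurd h hqr)
    · exact key _ (cs.isReducedMinimal_star hij hri hrj hri hrj h3 hMri hMrj hMri hMrj
        fun _ => hr3)
  by_cases h4 : M i j = 4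
  · have key : ∀ ω : List B, cs.IsReducedMinimal (i :: ω) i j →
        ∃ ω, cs.IsReduced (ω ++ [j, i]) ∧ [i, j].Sublist ω := fun ω h =>
      ⟨(i :: ω) ++ [j, i], by
        rw [List.append_assoc]
        exact h.isReduced_append hij (k := 4) (by lia), by
        rw [List.cons_append]
        exact (List.Sublist.trans (by simp) (List.sublist_append_right ω [j, i])).cons_cons i⟩
    obtain ⟨r, hri, hrj, hr⟩ := cs.exists_adjacent_pair hCox hij h2 (by lia) (by lia)
    rcases hr with hr | hr
    · exact key _ (cs.isReducedMinimal_pair hij hri hrj hr)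
    · exact key _ (cs.isReducedMinimal_triple hij hri hrj hr (.inl (M.symmetric i j ▸ h2)))
  have h1 := M.off_diagonal i j hij
  exact ⟨[i, j, i], (cs.isReducedMinimal_nil i j).isReduced_append hij (k := 5) (by lia), hsub _⟩

end CoxeterSystem

/-- Let `(W, S)` be a finite Coxeter system, each of whose irreducible
factors has Coxeter number at least `5` (the Coxeter number of an irreducible component is
the order of the product of all the simple reflections of that component, taken in any
order).  Then for any two simple reflections `s`, `t`, the element `s * t` is small, i.e.
`s t ≤ w₀ s t` in the Bruhat order, where `w₀` is the longest element. -/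
theorem product_of_two_simples_is_small {B W : Type*} [Group W] [Finite W] [Finite B]
    {M : CoxeterMatrix B} (cs : CoxeterSystem M W)
    (hCox : ∀ i : B, ∀ l : List B, l.Nodup →
      (∀ j : B, j ∈ l ↔ M.SameComponent i j) → 5 ≤ orderOf (cs.wordProd l))
    (w₀ : W) (hw₀max : ∀ w : W, cs.length w ≤ cs.length w₀)
    (hw₀uniq : ∀ w : W, cs.length w = cs.length w₀ → w = w₀) :
    ∀ i j : B, cs.bruhatLE (cs.simple i * cs.simple j)
      (w₀ * (cs.simple i * cs.simple j)) := by
  intro i j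
  by_cases hij : i = j
  · subst hij
    obtain ⟨ω, hω, h⟩ := cs.exists_isReduced w₀
    exact ⟨ω, hω, by simp [h], [], List.nil_sublist ω, by simp⟩
  · obtain ⟨ω, hω, hsub⟩ := cs.exists_isReduced_append_pair hCox hij
    exact cs.bruhatLE_longest_mul_s4 hw₀max hω hsub
end

section
/- Let n >= 2 and 1 <= k <= n-1, and let z_k be the permutation in S_n given by z_k(1) = k, z_k(n) = k+1, z_k(i) = n-i+2 for 1 < i <= n-k, and z_k(i) = n-i for n-k < i < n. Then for every x in S_n: x <= z_k in the Bruhat order on S_n if and only if x(1) <= k and x(n) >= k+1. -/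
/-- `ap σ i` is the value, in one-indexed notation, of the permutation `σ ∈ Sₙ` at the
one-indexed position `i`; i.e. writing `σ` as the tuple `(σ(1), …, σ(n))` of elements of
`{1, …, n}`, `ap σ i = σ(i)` for `1 ≤ i ≤ n` (and junk value `0` otherwise). -/
def ap {n : ℕ} (σ : Equiv.Perm (Fin n)) (i : ℕ) : ℕ :=
  if h : 1 ≤ i ∧ i ≤ n then (σ ⟨i - 1, by omega⟩ : ℕ) + 1 else 0

/-- The number of inversions of a permutation in `Sₙ`, which equals its Coxeter length
with respect to the generating set of adjacent transpositions. -/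
def invCount {n : ℕ} (σ : Equiv.Perm (Fin n)) : ℕ :=
  (Finset.univ.filter fun p : Fin n × Fin n => p.1 < p.2 ∧ σ p.2 < σ p.1).card

/-- A permutation is an adjacent transposition `sᵢ = (i, i+1)`. -/
def IsAdjSwap {n : ℕ} (σ : Equiv.Perm (Fin n)) : Prop :=
  ∃ i j : Fin n, (i : ℕ) + 1 = (j : ℕ) ∧ σ = Equiv.swap i j

/-- A word in the adjacent transpositions. -/
def IsWord {n : ℕ} (l : List (Equiv.Perm (Fin n))) : Prop := ∀ τ ∈ l, IsAdjSwap τ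

/-- A reduced word: a word in the adjacent transpositions of minimal length among all
words representing the same permutation. -/
def IsReducedWord {n : ℕ} (l : List (Equiv.Perm (Fin n))) : Prop :=
  IsWord l ∧ ∀ l' : List (Equiv.Perm (Fin n)), IsWord l' → l'.prod = l.prod →
    l.length ≤ l'.length

/-- The Bruhat order on `Sₙ`: `x ≤ y` iff `x` is the product of a subword of some
reduced word for `y` in the adjacent transpositions. -/
def bruhatLE {n : ℕ} (x y : Equiv.Perm (Fin n)) : Prop :=
  ∃ l : List (Equiv.Perm (Fin n)), IsReducedWord l ∧ l.prod = y ∧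
    ∃ l' : List (Equiv.Perm (Fin n)), l'.Sublist l ∧ l'.prod = x

/-- The one-indexed tuple of the permutation `z_k ∈ Sₙ`, namely `(k, …, k+1)` where the
middle entries are the elements of `{1, …, n} \ {k, k+1}` in decreasing order:
`z_k(1) = k`, `z_k(n) = k+1`, `z_k(i) = n-i+2` for `1 < i ≤ n-k`, and `z_k(i) = n-i`
for `n-k < i < n`. -/
def zVal (n k i : ℕ) : ℕ :=
  if i = 1 then k else if i = n then k + 1 else if i ≤ n - k then n - i + 2 else n - i

open Equiv

theorem IsReducedWord.of_cons {n : ℕ} {s : Perm (Fin n)} {l : List (Perm (Fin n))}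
    (h : IsReducedWord (s :: l)) : IsReducedWord l := by
  have hw : IsAdjSwap s ∧ IsWord l := List.forall_mem_cons.1 h.1
  refine ⟨hw.2, fun l' hl' hp => ?_⟩
  have := h.2 (s :: l') (List.forall_mem_cons.2 ⟨hw.1, hl'⟩) (by simp [hp])
  simpa using this

/-- The strong exchange condition: undoing an inversion of the product of a word amounts to
deleting one of its letters. -/
theorem IsWord.exists_sublist_prod_eq_mul_swap {n : ℕ} {l : List (Perm (Fin n))}
    (hl : IsWord l) {p q : Fin n} (hpq : p < q) (h : l.prod q < l.prod p) :
    ∃ l' : List (Perm (Fin n)), l'.Sublist l ∧ l'.length + 1 = l.length ∧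
      l'.prod = l.prod * swap p q := by
  induction l with
  | nil => exact absurd h (by simpa using hpq.le)
  | cons t l ih =>
    obtain ⟨⟨i, j, hij, rfl⟩, hl'⟩ : IsAdjSwap t ∧ IsWord l := List.forall_mem_cons.1 hl
    rw [List.prod_cons, Perm.mul_apply, Perm.mul_apply] at h
    rcases lt_or_ge (l.prod q) (l.prod p) with hlt | hge
    · obtain ⟨l', hs, hlen, hp⟩ := ih hl' hlt
      exact ⟨swap i j :: l', hs.cons_cons _, by simpa using hlen, by simp [hp, mul_assoc]⟩
    · refine ⟨l, List.sublist_cons_self _ _, rfl, ?_⟩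
      obtain ⟨hp, hq⟩ : l.prod p = i ∧ l.prod q = j := by
        have hne := l.prod.injective.ne hpq.ne
        simp only [swap_apply_def] at h
        grind
      rw [List.prod_cons, mul_assoc, mul_swap_eq_swap_mul, hp, hq, swap_mul_self_mul]

theorem IsReducedWord.inv_lt_inv {n : ℕ} {i j : Fin n} {l : List (Perm (Fin n))}
    (h : IsReducedWord (swap i j :: l)) (hij : i < j) : l.prod⁻¹ i < l.prod⁻¹ j := by
  by_contra hlt
  have hne : l.prod⁻¹ i ≠ l.prod⁻¹ j := l.prod⁻¹.injective.ne hij.ne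
  obtain ⟨l', hs, hlen, hp⟩ := h.of_cons.1.exists_sublist_prod_eq_mul_swap
    (p := l.prod⁻¹ j) (q := l.prod⁻¹ i) (by grind) (by simpa using hij)
  have := h.2 l' (fun τ hτ => h.of_cons.1 τ (hs.subset hτ))
    (by rw [hp, mul_swap_eq_swap_mul]; simp [swap_comm])
  simp at this
  omega

theorem IsReducedWord.sublist_prod_apply_le {n : ℕ} {l l' : List (Perm (Fin n))}
    (h : IsReducedWord l) (hs : l'.Sublist l) {p : Fin n} (hp : IsBot p) :
    l'.prod p ≤ l.prod p := by
  induction hs with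
  | slnil => rfl
  | @cons l₁ l₂ t hs ih =>
    obtain ⟨i, j, hij, rfl⟩ := h.1 t List.mem_cons_self
    have hlt := h.inv_lt_inv (i := i) (j := j) (by grind)
    have := ih h.of_cons
    have := hp (l₂.prod⁻¹ i)
    simp only [List.prod_cons, Perm.mul_apply, swap_apply_def]
    grind [Perm.eq_inv_iff_eq]
  | @cons_cons l₁ l₂ t hs ih =>
    obtain ⟨i, j, hij, rfl⟩ := h.1 t List.mem_cons_self
    have hlt := h.inv_lt_inv (i := i) (j := j) (by grind)
    have := ih h.of_cons
    have := hp (l₂.prod⁻¹ i)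
    simp only [List.prod_cons, Perm.mul_apply, swap_apply_def]
    grind [Perm.eq_inv_iff_eq]

theorem IsReducedWord.le_sublist_prod_apply {n : ℕ} {l l' : List (Perm (Fin n))}
    (h : IsReducedWord l) (hs : l'.Sublist l) {p : Fin n} (hp : IsTop p) :
    l.prod p ≤ l'.prod p := by
  induction hs with
  | slnil => rfl
  | @cons l₁ l₂ t hs ih =>
    obtain ⟨i, j, hij, rfl⟩ := h.1 t List.mem_cons_self
    have hlt := h.inv_lt_inv (i := i) (j := j) (by grind)
    have := ih h.of_cons
    have := hp (l₂.prod⁻¹ j)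
    simp only [List.prod_cons, Perm.mul_apply, swap_apply_def]
    grind [Perm.eq_inv_iff_eq]
  | @cons_cons l₁ l₂ t hs ih =>
    obtain ⟨i, j, hij, rfl⟩ := h.1 t List.mem_cons_self
    have hlt := h.inv_lt_inv (i := i) (j := j) (by grind)
    have := ih h.of_cons
    have := hp (l₂.prod⁻¹ j)
    simp only [List.prod_cons, Perm.mul_apply, swap_apply_def]
    grind [Perm.eq_inv_iff_eq]

theorem exists_isReducedWord_prod_eq {n : ℕ} (σ : Perm (Fin n)) :
    ∃ l : List (Perm (Fin n)), IsReducedWord l ∧ l.prod = σ := by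
  obtain ⟨l, hl, hp⟩ : ∃ l : List (Perm (Fin n)), IsWord l ∧ l.prod = σ := by
    cases n with
    | zero => exact ⟨[], by simp [IsWord], Subsingleton.elim _ _⟩
    | succ n =>
      have hσ : σ ∈ Submonoid.closure (Set.range fun i : Fin n => swap i.castSucc i.succ) := by
        rw [Perm.mclosure_swap_castSucc_succ]
        trivial
      obtain ⟨l, hl, hp⟩ := Submonoid.exists_list_of_mem_closure hσ
      refine ⟨l, fun τ hτ => ?_, hp⟩
      obtain ⟨i, rfl⟩ := hl τ hτ
      exact ⟨i.castSucc, i.succ, by simp, rfl⟩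
  obtain ⟨l₀, ⟨hl₀, hp₀⟩, hmin⟩ := exists_minimalFor_of_wellFoundedLT
    (fun l : List (Perm (Fin n)) => IsWord l ∧ l.prod = σ) List.length ⟨l, hl, hp⟩
  refine ⟨l₀, ⟨hl₀, fun l' hl' hp' => ?_⟩, hp₀⟩
  exact (le_total _ _).elim id (hmin ⟨hl', hp'.trans hp₀⟩)

/-- A permutation is determined by its values at the two end positions when it is decreasing in
between. -/
theorem perm_eq_of_ends_of_antitone {n : ℕ} {x z : Perm (Fin n)} {a b : Fin n} (ha : IsBot a)
    (hb : IsTop b) (hza : x a = z a) (hzb : x b = z b)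
    (hx : ∀ p q, a < p → p < q → q < b → x q < x p)
    (hz : ∀ p q, a < p → p < q → q < b → z q < z p) : x = z := by
  have hinv (v : Fin n) : z (z⁻¹ v) = v := by simp
  have hw : Monotone (z⁻¹ * x) := by
    intro p q hpq
    have hp := ha p
    have hq := hb q
    have hne (r c : Fin n) (hc : x c = z c) (hr : r ≠ c) : z⁻¹ (x r) ≠ c := fun h =>
      hr (x.injective (by rw [hc, ← h, hinv]))
    have hx' := hx p q
    have hz' := hz (z⁻¹ (x q)) (z⁻¹ (x p))
    simp only [hinv, Perm.mul_apply] at hz' ⊢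
    have h1 : z⁻¹ (x a) = a := by simp [hza]
    have h2 : z⁻¹ (x b) = b := by simp [hzb]
    have h3 := hne p a hza
    have h4 := hne p b hzb
    have h5 := hne q a hza
    have h6 := hne q b hzb
    have h7 := ha (z⁻¹ (x p))
    have h8 := ha (z⁻¹ (x q))
    have h9 := hb (z⁻¹ (x p))
    have h10 := hb (z⁻¹ (x q))
    clear hx hz hne
    grind
  exact (inv_mul_eq_one.1 ((Perm.monotone_iff _).1 hw)).symm

theorem exists_swap_of_ne {n : ℕ} {x z : Perm (Fin n)} {a b : Fin n} (ha : IsBot a)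
    (hb : IsTop b) (hab : (z a : ℕ) + 1 = z b)
    (hz : ∀ p q, a < p → p < q → q < b → z q < z p)
    (hxa : x a ≤ z a) (hxb : z b ≤ x b) (hne : x ≠ z) :
    ∃ p q, p < q ∧ x p < x q ∧ (x * swap p q) a ≤ z a ∧ z b ≤ (x * swap p q) b := by
  have hlt : a < b := by grind [ha b]
  by_cases hx : ∀ p q, a < p → p < q → q < b → x q < x p
  · rcases hxa.lt_or_eq with hlta | hxa
    · refine ⟨a, x⁻¹ (z a), ?_⟩
      have h1 := ha (x⁻¹ (z a))
      have h2 : x (x⁻¹ (z a)) = z a := by simp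
      simp only [Perm.mul_apply, swap_apply_def]
      grind
    · have hltb : z b < x b := lt_of_le_of_ne hxb fun h =>
        hne (perm_eq_of_ends_of_antitone ha hb hxa h.symm hx hz)
      refine ⟨x⁻¹ (z b), b, ?_⟩
      have h1 := hb (x⁻¹ (z b))
      have h2 : x (x⁻¹ (z b)) = z b := by simp
      simp only [Perm.mul_apply, swap_apply_def]
      grind
  · push Not at hx
    obtain ⟨p, q, hp, hpq, hq, hle⟩ := hx
    refine ⟨p, q, hpq, lt_of_le_of_ne hle (x.injective.ne hpq.ne), ?_⟩
    simp only [Perm.mul_apply, swap_apply_def]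
    grind

theorem IsWord.exists_sublist_prod_eq {n : ℕ} {l : List (Perm (Fin n))} (hl : IsWord l)
    {a b : Fin n} (ha : IsBot a) (hb : IsTop b) (hab : (l.prod a : ℕ) + 1 = l.prod b)
    (hanti : ∀ p q, a < p → p < q → q < b → l.prod q < l.prod p)
    (x : Perm (Fin n)) (hxa : x a ≤ l.prod a) (hxb : l.prod b ≤ x b) :
    ∃ l' : List (Perm (Fin n)), l'.Sublist l ∧ l'.prod = x := by
  induction hf : toLex (x : Fin n → Fin n) using WellFoundedGT.induction generalizing x with
  | ind f ih =>
    subst hf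
    by_cases hne : x = l.prod
    · exact ⟨l, List.Sublist.refl _, hne.symm⟩
    obtain ⟨p, q, hpq, hlt, hya, hyb⟩ := exists_swap_of_ne ha hb hab hanti hxa hxb hne
    set y := x * swap p q with hy
    have hyx : y * swap p q = x := by simp [hy, mul_assoc]
    have hlt' : y q < y p := by simpa [hy] using hlt
    obtain ⟨l₁, hs₁, hp₁⟩ := ih (toLex y)
      (by simpa [← hyx] using Pi.lex_desc hpq.le hlt') y hya hyb rfl
    obtain ⟨l₂, hs₂, -, hp₂⟩ := IsWord.exists_sublist_prod_eq_mul_swap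
      (fun τ hτ => hl τ (hs₁.subset hτ)) hpq (by rwa [hp₁])
    exact ⟨l₂, hs₂.trans hs₁, by rw [hp₂, hp₁, hyx]⟩

/-- Let `n ≥ 2` and `1 ≤ k ≤ n - 1`, and let `z = z_k ∈ Sₙ`.  Then for
every `x ∈ Sₙ`: `x ≤ z_k` in the Bruhat order iff `x(1) ≤ k` and `x(n) ≥ k + 1`. -/
theorem le_zk_iff (n k : ℕ) (hn : 2 ≤ n) (hk1 : 1 ≤ k) (hk2 : k ≤ n - 1)
    (z : Equiv.Perm (Fin n))
    (hz : ∀ i : ℕ, 1 ≤ i → i ≤ n → ap z i = zVal n k i)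
    (x : Equiv.Perm (Fin n)) :
    bruhatLE x z ↔ ap x 1 ≤ k ∧ k + 1 ≤ ap x n := by
  have hap (σ : Perm (Fin n)) (i : Fin n) : ap σ (i + 1) = σ i + 1 := by
    simp [ap]
  obtain ⟨a, ha⟩ : ∃ a : Fin n, (a : ℕ) = 0 := ⟨⟨0, by omega⟩, rfl⟩
  obtain ⟨b, hb⟩ : ∃ b : Fin n, (b : ℕ) + 1 = n := ⟨⟨n - 1, by omega⟩, by simp; omega⟩
  have hval (i : Fin n) : (z i : ℕ) + 1 = zVal n k (i + 1) := by
    rw [← hap, hz _ (by omega) (by omega)]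
  have hza : (z a : ℕ) + 1 = k := by simp [hval, zVal, ha]
  have hzb : (z b : ℕ) = k := by
    have := hval b
    simp only [zVal] at this
    grind
  have hbot : IsBot a := fun i => by grind
  have htop : IsTop b := fun i => by grind
  have hxa : ap x 1 = x a + 1 := by simpa [ha] using hap x a
  have hxb : ap x n = x b + 1 := by simpa [hb] using hap x b
  have hends : ap x 1 ≤ k ∧ k + 1 ≤ ap x n ↔ x a ≤ z a ∧ z b ≤ x b := by
    rw [Fin.le_def, Fin.le_def]
    omega
  rw [hends]
  constructor
  · rintro ⟨l, hl, rfl, l', hs, rfl⟩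
    exact ⟨hl.sublist_prod_apply_le hs hbot, hl.le_sublist_prod_apply hs htop⟩
  · rintro ⟨hxa, hxb⟩
    obtain ⟨l, hl, rfl⟩ := exists_isReducedWord_prod_eq z
    refine ⟨l, hl, rfl, hl.1.exists_sublist_prod_eq hbot htop (by omega) ?_ x hxa hxb⟩
    intro p q hp hpq hq
    have hvp := hval p
    have hvq := hval q
    simp only [zVal] at hvp hvq
    grind
end

section
/- Let n >= 2. The incidence set I_{1,n-1} := { x in S_n : x(1) < x(n) } is a balanced ideal of the Bruhat order on S_n which is invariant under right multiplication by the subgroup W_{1,n-1} = { w in S_n : w(1) = 1 and w(n) = n }. That is: (a) I_{1,n-1} is downward closed for the Bruhat order; (b) w_0 * (S_n \ I_{1,n-1}) = I_{1,n-1}, where w_0(i) = n+1-i; (c) I_{1,n-1} * W_{1,n-1} = I_{1,n-1}; and (d) I_{1,n-1} is the union over k = 1,...,n-1 of the principal ideals { x : x <= z_k }, with the elements z_1,...,z_{n-1} pairwise incomparable in the Bruhat order (so {z_1,...,z_{n-1}} is the minimal generating set of I_{1,n-1}). -/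
/-- The number of positions `a < p` at which `x` takes a value at least `q`. -/
def rankCount {n : ℕ} (x : Equiv.Perm (Fin n)) (p q : ℕ) : ℕ :=
  (Finset.univ.filter fun a : Fin n => (a : ℕ) < p ∧ q ≤ (x a : ℕ)).card

section Inversions

variable {n : ℕ}

theorem invCount_mul_swap (x : Equiv.Perm (Fin n)) {i j : Fin n} (h : (i : ℕ) + 1 = j)
    (hx : x i < x j) : invCount (x * Equiv.swap i j) = invCount x + 1 := by
  have key : (Finset.univ.filter fun p : Fin n × Fin n =>
        p.1 < p.2 ∧ (x * Equiv.swap i j) p.2 < (x * Equiv.swap i j) p.1) =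
      insert (i, j) ((Finset.univ.filter fun p : Fin n × Fin n =>
        p.1 < p.2 ∧ x p.2 < x p.1).map
          ((Equiv.swap i j).prodCongr (Equiv.swap i j)).toEmbedding) := by
    ext ⟨a, b⟩
    simp only [Finset.mem_insert, Finset.mem_map_equiv, Finset.mem_filter, Finset.mem_univ,
      true_and, Equiv.prodCongr_symm, Equiv.prodCongr_apply,
      Equiv.symm_swap, Prod.map_apply, Prod.mk.injEq]
    simp only [Equiv.Perm.mul_apply, Equiv.swap_apply_def]
    split_ifs <;> subst_vars <;>
      simp only [Fin.ext_iff, Fin.lt_def, and_self, true_or, iff_true] at * <;> omega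
  unfold invCount
  rw [key, Finset.card_insert_of_notMem, Finset.card_map]
  simp only [Finset.mem_map_equiv, Finset.mem_filter, Finset.mem_univ, true_and,
    Equiv.prodCongr_symm, Equiv.prodCongr_apply, Equiv.symm_swap, Prod.map_apply,
    Equiv.swap_apply_left, Equiv.swap_apply_right, Fin.lt_def]
  omega

theorem invCount_eq_mul_swap_add_one (x : Equiv.Perm (Fin n)) {i j : Fin n}
    (h : (i : ℕ) + 1 = j) (hx : x j < x i) :
    invCount x = invCount (x * Equiv.swap i j) + 1 := by
  simpa [mul_assoc] using invCount_mul_swap (x * Equiv.swap i j) h (by simpa using hx)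

theorem eq_one_of_forall_lt (x : Equiv.Perm (Fin n))
    (hx : ∀ i j : Fin n, (i : ℕ) + 1 = j → x i < x j) : x = 1 := by
  have hm : StrictMono x := by
    cases n with
    | zero => exact fun a => a.elim0
    | succ m => exact Fin.strictMono_iff_lt_succ.2 fun i => hx _ _ (by simp)
  have hm' : StrictMono x.symm := fun a b hab => by
    rw [← hm.lt_iff_lt]
    simpa using hab
  ext a
  have h1 : a ≤ x a := hm.le_apply
  have h2 : x a ≤ x.symm (x a) := hm'.le_apply
  rw [Equiv.symm_apply_apply] at h2
  simp [le_antisymm h2 h1]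

theorem exists_descent {x : Equiv.Perm (Fin n)} (hx : x ≠ 1) :
    ∃ i j : Fin n, (i : ℕ) + 1 = j ∧ x j < x i := by
  by_contra! hc
  refine hx (eq_one_of_forall_lt x fun i j h => lt_of_le_of_ne (hc i j h) fun he => ?_)
  have := x.injective he
  omega

theorem invCount_one : invCount (1 : Equiv.Perm (Fin n)) = 0 := by
  simp only [invCount, Finset.card_eq_zero, Finset.filter_eq_empty_iff]
  rintro p - ⟨h1, h2⟩
  exact lt_asymm h1 h2

theorem IsWord.concat {l : List (Equiv.Perm (Fin n))} (hl : IsWord l) {i j : Fin n}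
    (h : (i : ℕ) + 1 = j) : IsWord (l ++ [Equiv.swap i j]) := by
  intro τ hτ
  rcases List.mem_append.1 hτ with hτ | hτ
  · exact hl τ hτ
  · exact ⟨i, j, h, List.mem_singleton.1 hτ⟩

theorem IsWord.invCount_prod_le {l : List (Equiv.Perm (Fin n))} (hl : IsWord l) :
    invCount l.prod ≤ l.length := by
  induction l using List.reverseRecOn with
  | nil => simp [invCount_one]
  | append_singleton l s ih =>
    have h1 := ih fun τ hτ => hl τ (by simp [hτ])
    obtain ⟨i, j, h, rfl⟩ := hl s (by simp)
    simp only [List.prod_append, List.prod_singleton, List.length_append, List.length_singleton]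
    rcases lt_or_ge (l.prod i) (l.prod j) with hlt | hge
    · have := invCount_mul_swap l.prod h hlt
      omega
    · have hne : l.prod j ≠ l.prod i := fun he => by
        have := l.prod.injective he
        omega
      have := invCount_eq_mul_swap_add_one l.prod h (lt_of_le_of_ne hge hne)
      omega

theorem exists_isWord_length_eq_invCount (x : Equiv.Perm (Fin n)) :
    ∃ l : List (Equiv.Perm (Fin n)), IsWord l ∧ l.prod = x ∧ l.length = invCount x := by
  induction hm : invCount x generalizing x with
  | zero =>
    by_cases hx : x = 1
    · exact ⟨[], by simp [IsWord], by simp [hx], rfl⟩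
    · obtain ⟨i, j, h, hlt⟩ := exists_descent hx
      have := invCount_eq_mul_swap_add_one x h hlt
      omega
  | succ m ih =>
    have hx : x ≠ 1 := by
      rintro rfl
      simp [invCount_one] at hm
    obtain ⟨i, j, h, hlt⟩ := exists_descent hx
    have := invCount_eq_mul_swap_add_one x h hlt
    obtain ⟨l, hl, hp, hlen⟩ := ih (x * Equiv.swap i j) (by omega)
    exact ⟨l ++ [Equiv.swap i j], hl.concat h, by simp [hp, mul_assoc], by simp [hlen]⟩

theorem isReducedWord_iff {l : List (Equiv.Perm (Fin n))} :
    IsReducedWord l ↔ IsWord l ∧ l.length = invCount l.prod := by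
  constructor
  · rintro ⟨hl, hmin⟩
    obtain ⟨l', hl', hp, hlen⟩ := exists_isWord_length_eq_invCount l.prod
    exact ⟨hl, le_antisymm (hlen ▸ hmin l' hl' hp) hl.invCount_prod_le⟩
  · rintro ⟨hl, hlen⟩
    exact ⟨hl, fun l' hl' hp => hlen ▸ hp ▸ hl'.invCount_prod_le⟩

end Inversions

section Rank

variable {n : ℕ}

theorem rankCount_succ (x : Equiv.Perm (Fin n)) (i : Fin n) (q : ℕ) :
    rankCount x (i + 1) q = rankCount x i q + if q ≤ (x i : ℕ) then 1 else 0 := by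
  have hun : (Finset.univ.filter fun a : Fin n => (a : ℕ) < i + 1 ∧ q ≤ (x a : ℕ)) =
      (Finset.univ.filter fun a : Fin n => (a : ℕ) < i ∧ q ≤ (x a : ℕ)) ∪
        (({i} : Finset (Fin n)).filter fun a => q ≤ (x a : ℕ)) := by
    ext a
    simp only [Finset.mem_union, Finset.mem_filter, Finset.mem_univ, true_and,
      Finset.mem_singleton, Fin.ext_iff, Nat.lt_succ_iff_lt_or_eq]
    tauto
  have hd : Disjoint (Finset.univ.filter fun a : Fin n => (a : ℕ) < i ∧ q ≤ (x a : ℕ))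
      (({i} : Finset (Fin n)).filter fun a => q ≤ (x a : ℕ)) := by
    rw [Finset.disjoint_left]
    intro a ha hb
    simp only [Finset.mem_filter, Finset.mem_singleton] at ha hb
    have := hb.1
    subst this
    omega
  unfold rankCount
  rw [hun, Finset.card_union_of_disjoint hd, Finset.filter_singleton]
  split_ifs <;> simp

theorem rankCount_zero (x : Equiv.Perm (Fin n)) (q : ℕ) : rankCount x 0 q = 0 := by
  simp [rankCount]

theorem rankCount_of_le (x : Equiv.Perm (Fin n)) {p : ℕ} (hp : n ≤ p) (q : ℕ) :
    rankCount x p q = (Finset.univ.filter fun a : Fin n => q ≤ (a : ℕ)).card :=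
  Finset.card_equiv x fun a => by simp [a.isLt.trans_le hp]

theorem rankCount_mul_swap_of_ne (x : Equiv.Perm (Fin n)) {i j : Fin n} (h : (i : ℕ) + 1 = j)
    {p : ℕ} (hp : p ≠ j) (q : ℕ) :
    rankCount (x * Equiv.swap i j) p q = rankCount x p q := by
  unfold rankCount
  refine Finset.card_equiv (Equiv.swap i j) fun a => ?_
  have : ((a : ℕ) < p) ↔ ((Equiv.swap i j a : Fin n) : ℕ) < p := by
    rw [Equiv.swap_apply_def]
    split_ifs <;> simp_all [Fin.ext_iff] <;> omega
  simp only [Finset.mem_filter, Finset.mem_univ, true_and, this]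
  simp

theorem rankCount_adj (x : Equiv.Perm (Fin n)) {i j : Fin n} (h : (i : ℕ) + 1 = j) (q : ℕ) :
    rankCount x j q = rankCount x i q + (if q ≤ (x i : ℕ) then 1 else 0) ∧
    rankCount x (j + 1) q = rankCount x j q + (if q ≤ (x j : ℕ) then 1 else 0) ∧
    rankCount (x * Equiv.swap i j) j q =
      rankCount x i q + (if q ≤ (x j : ℕ) then 1 else 0) := by
  refine ⟨by rw [← h, rankCount_succ], rankCount_succ x j q, ?_⟩
  have := rankCount_succ (x * Equiv.swap i j) i q
  rwa [rankCount_mul_swap_of_ne x h (p := i) (by omega), Equiv.Perm.mul_apply, Equiv.swap_apply_left,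
    h] at this

theorem rankCount_le_of_bruhatLE {x y : Equiv.Perm (Fin n)} (hxy : bruhatLE x y) (p q : ℕ) :
    rankCount x p q ≤ rankCount y p q := by
  obtain ⟨l, hl, rfl, l', hsub, rfl⟩ := hxy
  rw [isReducedWord_iff] at hl
  obtain ⟨hl, hlen⟩ := hl
  induction l using List.reverseRecOn generalizing l' p q with
  | nil => simp [List.sublist_nil.1 hsub]
  | append_singleton l s ih =>
    have hw : IsWord l := fun τ hτ => hl τ (by simp [hτ])
    obtain ⟨i, j, h, rfl⟩ := hl s (by simp)
    simp only [List.prod_append, List.prod_singleton, List.length_append,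
      List.length_singleton] at hlen ⊢
    have hle := hw.invCount_prod_le
    have hlt : l.prod i < l.prod j := by
      by_contra hge
      have hne : l.prod j ≠ l.prod i := fun he => by
        have := l.prod.injective he
        omega
      have := invCount_eq_mul_swap_add_one l.prod h (lt_of_le_of_ne (not_lt.1 hge) hne)
      omega
    have hlen' : l.length = invCount l.prod := by
      have := invCount_mul_swap l.prod h hlt
      omega
    obtain ⟨m, t, rfl, hm, ht⟩ := List.sublist_append_iff.1 hsub
    have ih' := fun p q => ih p q m hm hw hlen'
    rw [Fin.lt_def] at hlt
    have hy := rankCount_adj l.prod h q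
    have hx := rankCount_adj m.prod h q
    have i1 := ih' i q
    have i2 := ih' j q
    have i3 := ih' (j + 1) q
    have ht' : t = [] ∨ t = [Equiv.swap i j] := by
      rcases List.sublist_singleton.1 ht with ht | ht <;> simp [ht]
    by_cases hp : p = j
    · subst hp
      rcases ht' with rfl | rfl
      · simp only [List.append_nil]
        split_ifs at * <;> omega
      · simp only [List.prod_append, List.prod_singleton]
        split_ifs at * <;> omega
    · rw [rankCount_mul_swap_of_ne _ h hp]
      rcases ht' with rfl | rfl
      · simpa using ih' p q
      · simpa [rankCount_mul_swap_of_ne _ h hp] using ih' p q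

theorem eq_one_of_rankCount_le {x : Equiv.Perm (Fin n)}
    (hx : ∀ p q, rankCount x p q ≤ rankCount (1 : Equiv.Perm (Fin n)) p q) : x = 1 := by
  have hle : ∀ a, (x a : ℕ) ≤ a := by
    intro a
    by_contra! hlt
    have h1 := hx (a + 1) (a + 1)
    have h2 : rankCount (1 : Equiv.Perm (Fin n)) (a + 1) (a + 1) = 0 := by
      simp only [rankCount, Finset.card_eq_zero, Finset.filter_eq_empty_iff]
      rintro b -
      rw [Equiv.Perm.one_apply]
      omega
    have h3 := rankCount_succ x a (a + 1)
    rw [if_pos (by omega)] at h3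
    omega
  have heq : ∀ m : ℕ, ∀ a : Fin n, (a : ℕ) = m → x a = a := by
    intro m
    induction m using Nat.strong_induction_on with
    | _ m ih =>
      rintro a rfl
      rcases (hle a).lt_or_eq with hlt | he
      · exact x.injective (ih _ hlt _ rfl)
      · exact Fin.ext he
  ext a
  simp [heq a a rfl]

theorem bruhatLE_of_rankCount_le {x y : Equiv.Perm (Fin n)}
    (hxy : ∀ p q, rankCount x p q ≤ rankCount y p q) : bruhatLE x y := by
  induction hm : invCount y generalizing x y with
  | zero =>
    have hy : y = 1 := by
      by_contra hy
      obtain ⟨i, j, h, hlt⟩ := exists_descent hy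
      have := invCount_eq_mul_swap_add_one y h hlt
      omega
    subst hy
    exact ⟨[], isReducedWord_iff.2 ⟨by simp [IsWord], by simp [invCount_one]⟩, rfl, [],
      List.Sublist.refl _, (eq_one_of_rankCount_le hxy).symm⟩
  | succ m ih =>
    have hy : y ≠ 1 := by
      rintro rfl
      simp [invCount_one] at hm
    obtain ⟨i, j, h, hlt⟩ := exists_descent hy
    have hinv := invCount_eq_mul_swap_add_one y h hlt
    rw [Fin.lt_def] at hlt
    by_cases hx : (x j : ℕ) < x i
    · obtain ⟨l, hl, hp, l', hsub, hp'⟩ :=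
        ih (x := x * Equiv.swap i j) (y := y * Equiv.swap i j) (fun p q => by
          by_cases hpj : p = j
          · subst hpj
            have hy := rankCount_adj y h q
            have hx := rankCount_adj x h q
            have i1 := hxy i q
            have i2 := hxy j q
            have i3 := hxy (j + 1) q
            split_ifs at * <;> omega
          · simpa only [rankCount_mul_swap_of_ne _ h hpj] using hxy p q) (by omega)
      rw [isReducedWord_iff] at hl
      refine ⟨l ++ [Equiv.swap i j], isReducedWord_iff.2 ⟨hl.1.concat h, ?_⟩,
        by simp [hp, mul_assoc], l' ++ [Equiv.swap i j], hsub.append_right _,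
        by simp [hp', mul_assoc]⟩
      simp [hl.2, hp, mul_assoc, hinv]
    · obtain ⟨l, hl, hp, l', hsub, hp'⟩ :=
        ih (x := x) (y := y * Equiv.swap i j) (fun p q => by
          by_cases hpj : p = j
          · subst hpj
            have hy := rankCount_adj y h q
            have hx := rankCount_adj x h q
            have i1 := hxy i q
            have i2 := hxy j q
            have i3 := hxy (j + 1) q
            split_ifs at * <;> omega
          · simpa only [rankCount_mul_swap_of_ne _ h hpj] using hxy p q) (by omega)
      rw [isReducedWord_iff] at hl
      refine ⟨l ++ [Equiv.swap i j], isReducedWord_iff.2 ⟨hl.1.concat h, ?_⟩,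
        by simp [hp, mul_assoc], l', hsub.trans (List.sublist_append_left _ _), hp'⟩
      simp [hl.2, hp, mul_assoc, hinv]

theorem rankCount_one (x : Equiv.Perm (Fin n)) (f : Fin n) (hf : (f : ℕ) = 0) (q : ℕ) :
    rankCount x 1 q = if q ≤ (x f : ℕ) then 1 else 0 := by
  simpa [hf, rankCount_zero] using rankCount_succ x f q

theorem rankCount_last (x y : Equiv.Perm (Fin n)) (e : Fin n) (he : (e : ℕ) + 1 = n) (q : ℕ) :
    rankCount x e q + (if q ≤ (x e : ℕ) then 1 else 0) =
      rankCount y e q + if q ≤ (y e : ℕ) then 1 else 0 := by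
  rw [← rankCount_succ, ← rankCount_succ, rankCount_of_le x he.ge, rankCount_of_le y he.ge]

theorem apply_first_le_of_bruhatLE {x y : Equiv.Perm (Fin n)} (hxy : bruhatLE x y) (f : Fin n)
    (hf : (f : ℕ) = 0) : (x f : ℕ) ≤ y f := by
  have h := rankCount_le_of_bruhatLE hxy 1 (x f)
  rw [rankCount_one x f hf, rankCount_one y f hf] at h
  split_ifs at h <;> omega

theorem apply_last_le_of_bruhatLE {x y : Equiv.Perm (Fin n)} (hxy : bruhatLE x y) (e : Fin n)
    (he : (e : ℕ) + 1 = n) : (y e : ℕ) ≤ x e := by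
  have h := rankCount_le_of_bruhatLE hxy e (y e)
  have h' := rankCount_last x y e he (y e)
  split_ifs at h' <;> omega

/-- If the entries of `y` strictly between the first and the last position are decreasing, then
`x ≤ y` in the Bruhat order as soon as the first and the last entries allow it. -/
theorem bruhatLE_of_antitone_middle {x y : Equiv.Perm (Fin n)} (f e : Fin n)
    (hf : (f : ℕ) = 0) (he : (e : ℕ) + 1 = n)
    (hy : ∀ a b : Fin n, 0 < (a : ℕ) → a < b → b < e → y b ≤ y a)
    (hxf : x f ≤ y f) (hxe : y e ≤ x e) : bruhatLE x y := by
  rw [Fin.le_def] at hxf hxe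
  refine bruhatLE_of_rankCount_le fun p q => ?_
  rcases Nat.eq_zero_or_pos p with rfl | hp
  · simp [rankCount_zero]
  rcases le_or_gt n p with hnp | hnp
  · rw [rankCount_of_le x hnp, rankCount_of_le y hnp]
  by_cases hall : ∀ a : Fin n, 0 < (a : ℕ) → (a : ℕ) < p → q ≤ (y a : ℕ)
  · induction p, hp using Nat.le_induction with
    | base =>
      rw [rankCount_one x f hf, rankCount_one y f hf]
      split_ifs <;> omega
    | succ p hp ih =>
      have h1 := ih (by omega) fun a h0 ha => hall a h0 (by omega)
      have h2 := hall ⟨p, by omega⟩ hp (Nat.lt_succ_self p)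
      have hx := rankCount_succ x ⟨p, by omega⟩ q
      have hy := rankCount_succ y ⟨p, by omega⟩ q
      simp only at hx hy
      split_ifs at hx hy <;> omega
  · push Not at hall
    obtain ⟨c, hc0, hcp, hcq⟩ := hall
    have hsmall : ∀ a : Fin n, p ≤ a → a < e → (y a : ℕ) < q := fun a hpa hae =>
      lt_of_le_of_lt (Fin.le_def.1 (hy c a hc0 (Fin.lt_def.2 (by omega)) hae)) hcq
    have hpe : p ≤ e := by omega
    clear hcp hp hnp
    induction hd : (e : ℕ) - p generalizing p with
    | zero =>
      obtain rfl : p = e := by omega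
      have := rankCount_last x y e he q
      split_ifs at this <;> omega
    | succ d ih =>
      have h1 := ih (p + 1) (fun a ha => hsmall a (by omega)) (by omega) (by omega)
      have h2 := hsmall ⟨p, by omega⟩ le_rfl (Fin.lt_def.2 (by simp only; omega))
      have hx := rankCount_succ x ⟨p, by omega⟩ q
      have hy := rankCount_succ y ⟨p, by omega⟩ q
      simp only at hx hy
      split_ifs at hx hy <;> omega

end Rank

theorem ap_eq {n : ℕ} (x : Equiv.Perm (Fin n)) (a : Fin n) {i : ℕ} (h : (a : ℕ) + 1 = i) :
    ap x i = (x a : ℕ) + 1 := by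
  subst h
  simp [ap, Nat.succ_le_of_lt a.isLt]

/-- Let `n ≥ 2`.  The incidence set `I_{1,n-1} = {x ∈ Sₙ : x(1) < x(n)}`
is a balanced ideal of the Bruhat order on `Sₙ`, invariant under right multiplication by
the subgroup `W_{1,n-1} = {w : w(1) = 1 ∧ w(n) = n}`: (a) it is downward closed; (b)
`w₀ * (Sₙ \ I) = I` where `w₀(i) = n + 1 - i`; (c) `I * W_{1,n-1} = I`; (d) `I` is the
union of the principal ideals generated by `z_1, …, z_{n-1}`, and these elements are
pairwise incomparable in the Bruhat order (so they form the minimal generating set). -/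
theorem incidence_ideal_balanced (n : ℕ) (hn : 2 ≤ n)
    (w₀ : Equiv.Perm (Fin n)) (hw₀ : ∀ i : ℕ, 1 ≤ i → i ≤ n → ap w₀ i = n + 1 - i)
    (z : ℕ → Equiv.Perm (Fin n))
    (hz : ∀ k, 1 ≤ k → k ≤ n - 1 → ∀ i : ℕ, 1 ≤ i → i ≤ n → ap (z k) i = zVal n k i) :
    (∀ x y : Equiv.Perm (Fin n), bruhatLE x y →
        y ∈ {x : Equiv.Perm (Fin n) | ap x 1 < ap x n} →
        x ∈ {x : Equiv.Perm (Fin n) | ap x 1 < ap x n}) ∧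
    ((fun x => w₀ * x) '' {x : Equiv.Perm (Fin n) | ap x 1 < ap x n}ᶜ =
        {x : Equiv.Perm (Fin n) | ap x 1 < ap x n}) ∧
    (Set.image2 (· * ·) {x : Equiv.Perm (Fin n) | ap x 1 < ap x n}
        {w : Equiv.Perm (Fin n) | ap w 1 = 1 ∧ ap w n = n} =
        {x : Equiv.Perm (Fin n) | ap x 1 < ap x n}) ∧
    ({x : Equiv.Perm (Fin n) | ap x 1 < ap x n} =
        ⋃ k ∈ Set.Icc 1 (n - 1), {x : Equiv.Perm (Fin n) | bruhatLE x (z k)}) ∧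
    (∀ k k' : ℕ, k ∈ Set.Icc 1 (n - 1) → k' ∈ Set.Icc 1 (n - 1) → k ≠ k' →
        ¬ bruhatLE (z k) (z k')) := by
  obtain ⟨f, hf⟩ : ∃ f : Fin n, (f : ℕ) = 0 := ⟨⟨0, by omega⟩, rfl⟩
  obtain ⟨e, he⟩ : ∃ e : Fin n, (e : ℕ) + 1 = n := ⟨⟨n - 1, by omega⟩, by simp only; omega⟩
  have h1 : ∀ x : Equiv.Perm (Fin n), ap x 1 = x f + 1 := fun x => ap_eq x f (by omega)
  have hlast : ∀ x : Equiv.Perm (Fin n), ap x n = x e + 1 := fun x => ap_eq x e he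
  have hI : ∀ x : Equiv.Perm (Fin n), ap x 1 < ap x n ↔ (x f : ℕ) < x e := fun x => by
    rw [h1, hlast]
    omega
  have hw : ∀ a : Fin n, (w₀ a : ℕ) + a + 1 = n := fun a => by
    have h := hw₀ (a + 1) (by omega) (by omega)
    rw [ap_eq w₀ a rfl] at h
    omega
  have hzv : ∀ k, 1 ≤ k → k ≤ n - 1 → ∀ a : Fin n, (z k a : ℕ) + 1 = zVal n k (a + 1) :=
    fun k hk hk' a => by rw [← hz k hk hk' _ (by omega) (by omega), ap_eq (z k) a rfl]
  have hzf : ∀ k, 1 ≤ k → k ≤ n - 1 → (z k f : ℕ) + 1 = k := fun k hk hk' => by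
    simpa [hf, zVal] using hzv k hk hk' f
  have hze : ∀ k, 1 ≤ k → k ≤ n - 1 → (z k e : ℕ) = k := fun k hk hk' => by
    have h := hzv k hk hk' e
    rw [he, zVal, if_neg (by omega), if_pos rfl] at h
    omega
  simp only [hI]
  refine ⟨fun x y hxy hy => ?_, ?_, ?_, ?_, fun k k' hk hk' hne hle => ?_⟩
  · have hxf := apply_first_le_of_bruhatLE hxy f hf
    have hxe := apply_last_le_of_bruhatLE hxy e he
    simp only [Set.mem_ofPred_eq] at hy ⊢
    omega
  · ext x
    simp only [Set.mem_image, Set.mem_compl_iff, Set.mem_ofPred_eq]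
    constructor
    · rintro ⟨y, hy, rfl⟩
      have hne : (y f : ℕ) ≠ y e := fun h => by
        have := y.injective (Fin.ext h)
        omega
      have hwf := hw (y f)
      have hwe := hw (y e)
      simp only [Equiv.Perm.mul_apply]
      omega
    · intro hx
      refine ⟨w₀ * x, ?_, ?_⟩
      · have hwf := hw (x f)
        have hwe := hw (x e)
        simp only [Equiv.Perm.mul_apply]
        omega
      · ext a
        have ha := hw (x a)
        have ha' := hw (w₀ (x a))
        simp only [Equiv.Perm.mul_apply]
        omega
  · ext x
    simp only [Set.mem_image2, Set.mem_ofPred_eq]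
    constructor
    · rintro ⟨y, hy, w, ⟨hw1, hwn⟩, rfl⟩
      rw [h1] at hw1
      rw [hlast] at hwn
      have hwf : w f = f := Fin.ext (by omega)
      have hwe : w e = e := Fin.ext (by omega)
      simpa [hwf, hwe] using hy
    · intro hx
      refine ⟨x, hx, 1, ⟨?_, ?_⟩, mul_one x⟩
      · rw [h1, Equiv.Perm.one_apply, hf]
      · rw [hlast, Equiv.Perm.one_apply, he]
  · ext x
    simp only [Set.mem_iUnion, Set.mem_ofPred_eq, exists_prop, Set.mem_Icc]
    constructor
    · intro hx
      obtain ⟨k, hxk⟩ : ∃ k, (x f : ℕ) + 1 = k := ⟨_, rfl⟩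
      have hk : 1 ≤ k := by omega
      have hk' : k ≤ n - 1 := by omega
      have hkf := hzf k hk hk'
      have hke := hze k hk hk'
      refine ⟨k, ⟨hk, hk'⟩, bruhatLE_of_antitone_middle f e hf he
        (fun a b ha hab hbe => ?_) (Fin.le_def.2 (by omega)) (Fin.le_def.2 (by omega))⟩
      have hza := hzv k hk hk' a
      have hzb := hzv k hk hk' b
      rw [Fin.lt_def] at hab hbe
      rw [Fin.le_def]
      unfold zVal at hza hzb
      split_ifs at hza hzb <;> omega
    · rintro ⟨k, ⟨hk, hk'⟩, hle⟩
      have hxf := apply_first_le_of_bruhatLE hle f hf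
      have hxe := apply_last_le_of_bruhatLE hle e he
      have hkf := hzf k hk hk'
      have hke := hze k hk hk'
      omega
  · rw [Set.mem_Icc] at hk hk'
    have hxf := apply_first_le_of_bruhatLE hle f hf
    have hxe := apply_last_le_of_bruhatLE hle e he
    have hkf := hzf k hk.1 hk.2
    have hke := hze k hk.1 hk.2
    have hkf' := hzf k' hk'.1 hk'.2
    have hke' := hze k' hk'.1 hk'.2
    omega
end

section
/- Let n >= 2 and 1 <= k <= n-1. Among all permutations x in S_n with x(1) = k and x(n) = k+1, the permutation z_k is the unique one of maximal length: every such x with x != z_k satisfies l(x) < l(z_k). -/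
/-- The pairs of values `(a, b)`, `a < b`, that appear out of order in the tuple of `σ`. -/
def valueInversions {n : ℕ} (σ : Equiv.Perm (Fin n)) : Finset (Fin n × Fin n) :=
  Finset.univ.filter fun p => p.1 < p.2 ∧ σ.symm p.2 < σ.symm p.1

theorem mem_valueInversions {n : ℕ} {σ : Equiv.Perm (Fin n)} {a b : Fin n} :
    (a, b) ∈ valueInversions σ ↔ a < b ∧ σ.symm b < σ.symm a := by
  simp [valueInversions]

theorem card_valueInversions {n : ℕ} (σ : Equiv.Perm (Fin n)) :
    (valueInversions σ).card = invCount σ := by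
  refine Finset.card_nbij' (fun p => (σ.symm p.2, σ.symm p.1)) (fun p => (σ p.2, σ p.1))
    ?_ ?_ ?_ ?_ <;> intro p <;> simp +contextual [valueInversions]

/-- A permutation is determined by its value inversions. -/
theorem valueInversions_injective {n : ℕ} :
    Function.Injective (valueInversions : Equiv.Perm (Fin n) → Finset (Fin n × Fin n)) := by
  intro σ τ h
  have hmono : StrictMono (τ.trans σ.symm) := by
    intro i j hij
    simp only [Equiv.trans_apply]
    rcases lt_trichotomy (τ i) (τ j) with hlt | heq | hgt
    · by_contra hle
      have hne : σ.symm (τ j) ≠ σ.symm (τ i) := by simpa using hij.ne'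
      have hmem := mem_valueInversions.2 ⟨hlt, lt_of_le_of_ne (not_lt.1 hle) hne⟩
      rw [h, mem_valueInversions] at hmem
      exact absurd hmem.2 (by simpa using hij.le)
    · exact absurd (τ.injective heq) hij.ne
    · have hmem : (τ j, τ i) ∈ valueInversions τ :=
        mem_valueInversions.2 ⟨hgt, by simpa using hij⟩
      rw [← h, mem_valueInversions] at hmem
      exact hmem.2
  have hid : (τ.trans σ.symm : Fin n → Fin n) = id :=
    (hmono.range_inj strictMono_id).1 (by simp)
  ext i
  have hi := congrFun hid i
  simp only [Equiv.trans_apply, id, Equiv.symm_apply_eq] at hi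
  rw [hi]

theorem ap_succ {n : ℕ} (σ : Equiv.Perm (Fin n)) (i : Fin n) :
    ap σ ((i : ℕ) + 1) = (σ i : ℕ) + 1 := by
  have hi : 1 ≤ (i : ℕ) + 1 ∧ (i : ℕ) + 1 ≤ n := by omega
  simp [ap, hi]

/-- The middle entries of `z_k` are decreasing. -/
theorem zVal_lt_zVal {n k i j : ℕ} (hi : 1 < i) (hij : i < j) (hj : j < n) :
    zVal n k j < zVal n k i := by
  unfold zVal
  split_ifs <;> omega

/-- Let `n ≥ 2` and `1 ≤ k ≤ n - 1`.  Among all permutations `x ∈ Sₙ`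
with `x(1) = k` and `x(n) = k + 1`, the permutation `z_k` is the unique one of maximal
length: every such `x ≠ z_k` satisfies `ℓ(x) < ℓ(z_k)`. -/
theorem zk_unique_longest (n k : ℕ) (hn : 2 ≤ n) (hk1 : 1 ≤ k) (hk2 : k ≤ n - 1)
    (z : Equiv.Perm (Fin n))
    (hz : ∀ i : ℕ, 1 ≤ i → i ≤ n → ap z i = zVal n k i) :
    ∀ x : Equiv.Perm (Fin n), ap x 1 = k → ap x n = k + 1 → x ≠ z →
      invCount x < invCount z := by
  intro x hx1 hxn hne
  rw [← card_valueInversions, ← card_valueInversions]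
  have hsub : valueInversions x ⊆ valueInversions z := by
    rintro ⟨a, b⟩ hab
    rw [mem_valueInversions] at hab ⊢
    refine ⟨hab.1, ?_⟩
    by_contra hle
    obtain ⟨p, rfl⟩ := z.surjective a
    obtain ⟨q, rfl⟩ := z.surjective b
    simp only [Equiv.symm_apply_apply, not_lt] at hle hab
    have hpq : p < q := lt_of_le_of_ne hle fun h => by simp [h] at hab
    have hzp := hz (p + 1) (by omega) (by omega)
    have hzq := hz (q + 1) (by omega) (by omega)
    rw [ap_succ] at hzp hzq
    have hxz : ∀ i : Fin n, ap x ((i : ℕ) + 1) = (z i : ℕ) + 1 → x.symm (z i) = i := by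
      intro i hi
      rw [ap_succ] at hi
      rw [Equiv.symm_apply_eq]
      exact Fin.ext (by omega)
    by_cases hp : (p : ℕ) = 0
    · have hxp : x.symm (z p) = p := hxz p (by rw [hzp, hp, hx1]; simp [zVal])
      rw [hxp] at hab
      have := hab.2
      omega
    by_cases hq : (q : ℕ) + 1 = n
    · have hxq : x.symm (z q) = q := hxz q (by
        rw [hzq, hq, hxn, zVal, if_neg (by omega), if_pos rfl])
      rw [hxq] at hab
      have := hab.2
      omega
    have hdec : zVal n k (q + 1) < zVal n k (p + 1) :=
      zVal_lt_zVal (by omega) (by omega) (by omega)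
    have := hab.1
    omega
  exact Finset.card_lt_card
    (hsub.ssubset_of_ne fun h => hne (valueInversions_injective h))
end

section
/- Let j >= 1, n = 2j+1 and k = j(4j+3), so that the longest element of S_{2n} has length l(w_0) = n(2n-1) = 2k+1. Then there exists a permutation mu in S_{2n} with exactly k inversions and mu(2n) <= n. Consequently #{ x in S_{2n} : l(x) = k and x(2n) > n } < #{ x in S_{2n} : l(x) = k }; that is, the level set of length k is not contained in the principal balanced ideal I_{2n} = { w in S_{2n} : w(2n) > n }. -/
/-- The zero-indexed one-line notation of a permutation of `{0, …, 4j+1}`: two decreasing blocks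
of size `j + 1`, an increasing block of size `j`, and finally the `j` smallest values in
increasing order. -/
def blockFun (j i : ℕ) : ℕ :=
  if i ≤ j then 2 * j - i
  else if i ≤ 2 * j + 1 then 4 * j + 2 - i
  else if i ≤ 3 * j + 1 then i + j
  else i - (3 * j + 2)

theorem blockFun_lt {j i : ℕ} (hi : i < 4 * j + 2) : blockFun j i < 4 * j + 2 := by
  unfold blockFun
  split_ifs <;> omega

theorem blockFun_inj {j a b : ℕ} (ha : a < 4 * j + 2) (hb : b < 4 * j + 2)
    (h : blockFun j a = blockFun j b) : a = b := by
  unfold blockFun at h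
  split_ifs at h <;> omega

/-- The number of inversions of `blockFun j` whose left position is `i`. -/
def blockCode (j i : ℕ) : ℕ :=
  if i ≤ j then 2 * j - i
  else if i ≤ 2 * j + 1 then 3 * j + 1 - i
  else if i ≤ 3 * j + 1 then j
  else 0

theorem card_inversions_blockFun (j i : ℕ) :
    ((Finset.range (4 * j + 2)).filter fun b => i < b ∧ blockFun j b < blockFun j i).card =
      blockCode j i := by
  have key : ((Finset.range (4 * j + 2)).filter fun b => i < b ∧ blockFun j b < blockFun j i) =
      Finset.Ioc i (if i ≤ j then j else if i ≤ 2 * j + 1 then 2 * j + 1 else i) ∪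
      Finset.Ico (if i ≤ 3 * j + 1 then 3 * j + 2 else 4 * j + 2) (4 * j + 2) := by
    ext b
    simp only [Finset.mem_filter, Finset.mem_range, Finset.mem_union, Finset.mem_Ioc,
      Finset.mem_Ico]
    unfold blockFun
    split_ifs <;> omega
  rw [key, Finset.card_union_of_disjoint, Nat.card_Ioc, Nat.card_Ico]
  · unfold blockCode
    split_ifs <;> omega
  · rw [Finset.disjoint_left]
    intro b
    simp only [Finset.mem_Ioc, Finset.mem_Ico]
    split_ifs <;> omega

theorem sum_blockCode (j : ℕ) :
    ∑ i ∈ Finset.range (4 * j + 2), blockCode j i = j * (4 * j + 3) := by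
  have gauss : ∀ m : ℕ, 2 * ∑ x ∈ Finset.range (m + 1), (j + (m - x)) =
      (m + 1) * (2 * j + m) := by
    intro m
    have h := Finset.sum_range_reflect (fun x => j + x) (m + 1)
    simp only [Nat.add_sub_cancel] at h
    rw [h, Finset.sum_add_distrib, mul_add, mul_comm 2 (∑ i ∈ _, i), Finset.sum_range_id_mul_two]
    simp
    ring
  have h1 : ∑ x ∈ Finset.range (j + 1), blockCode j x =
      ∑ x ∈ Finset.range (j + 1), (j + (j - x)) := by
    refine Finset.sum_congr rfl fun x hx => ?_
    rw [Finset.mem_range] at hx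
    unfold blockCode
    split_ifs <;> omega
  have h2 : ∑ x ∈ Finset.range (j + 1), blockCode j (j + 1 + x) =
      ∑ x ∈ Finset.range (j + 1), (j + (j - x)) := by
    refine Finset.sum_congr rfl fun x hx => ?_
    rw [Finset.mem_range] at hx
    unfold blockCode
    split_ifs <;> omega
  have h3 : ∑ x ∈ Finset.range j, blockCode j (j + 1 + (j + 1) + x) =
      ∑ x ∈ Finset.range j, j := by
    refine Finset.sum_congr rfl fun x hx => ?_
    rw [Finset.mem_range] at hx
    unfold blockCode
    split_ifs <;> omega
  have h4 : ∑ x ∈ Finset.range j, blockCode j (j + 1 + (j + 1) + j + x) = 0 := by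
    refine Finset.sum_eq_zero fun x hx => ?_
    unfold blockCode
    split_ifs <;> omega
  rw [show 4 * j + 2 = j + 1 + (j + 1) + j + j by ring, Finset.sum_range_add,
    Finset.sum_range_add, Finset.sum_range_add, h1, h2, h3, h4]
  have := gauss j
  simp only [Finset.sum_const, Finset.card_range, smul_eq_mul]
  linarith

theorem invCount_eq_sum {N : ℕ} (σ : Equiv.Perm (Fin N)) (f : ℕ → ℕ)
    (hf : ∀ i : Fin N, (σ i : ℕ) = f i) :
    invCount σ = ∑ i ∈ Finset.range N,
      ((Finset.range N).filter fun b => i < b ∧ f b < f i).card := by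
  unfold invCount
  simp only [Finset.card_filter, Fintype.sum_prod_type, Finset.sum_range, Fin.lt_def, hf]

/-- The permutation of `Fin (4j+2)` with one-line notation `blockFun j`. -/
noncomputable def blockPerm (j : ℕ) : Equiv.Perm (Fin (4 * j + 2)) :=
  Equiv.ofBijective (fun i => ⟨blockFun j i, blockFun_lt i.2⟩) <|
    Finite.injective_iff_bijective.mp fun a b h =>
      Fin.ext (blockFun_inj a.2 b.2 (Fin.val_eq_of_eq h))

theorem invCount_blockPerm (j : ℕ) : invCount (blockPerm j) = j * (4 * j + 3) := by
  rw [invCount_eq_sum (blockPerm j) (blockFun j) fun _ => rfl, ← sum_blockCode]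
  exact Finset.sum_congr rfl fun i _ => card_inversions_blockFun j i

theorem ap_blockPerm_last {j : ℕ} (hj : 1 ≤ j) : ap (blockPerm j) (4 * j + 2) = j := by
  rw [ap, dif_pos (by omega)]
  change blockFun j (4 * j + 2 - 1) + 1 = j
  unfold blockFun
  split_ifs <;> omega

/-- Let `j ≥ 1`, `n = 2j + 1` and `k = j(4j + 3)`, so that the longest
element of `S₂ₙ` has length `n(2n - 1) = 2k + 1`.  Then there is a permutation `μ ∈ S₂ₙ`
with exactly `k` inversions and `μ(2n) ≤ n`.  Consequently
`#{x : ℓ(x) = k ∧ x(2n) > n} < #{x : ℓ(x) = k}`: the level set of length `k` is not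
contained in the principal balanced ideal `I₂ₙ = {w : w(2n) > n}`. -/
theorem middle_level_not_in_I2n (j n k : ℕ) (hj : 1 ≤ j) (hn : n = 2 * j + 1)
    (hk : k = j * (4 * j + 3)) :
    n * (2 * n - 1) = 2 * k + 1 ∧
    (∃ mu : Equiv.Perm (Fin (2 * n)), invCount mu = k ∧ ap mu (2 * n) ≤ n) ∧
    (Finset.univ.filter fun x : Equiv.Perm (Fin (2 * n)) =>
        invCount x = k ∧ n < ap x (2 * n)).card <
      (Finset.univ.filter fun x : Equiv.Perm (Fin (2 * n)) => invCount x = k).card := by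
  have hmu : ∃ mu : Equiv.Perm (Fin (2 * n)), invCount mu = k ∧ ap mu (2 * n) ≤ n := by
    obtain rfl : k = j * (4 * j + 3) := hk
    have hN : 2 * n = 4 * j + 2 := by omega
    rw [hN]
    exact ⟨blockPerm j, invCount_blockPerm j, by rw [ap_blockPerm_last hj]; omega⟩
  refine ⟨?_, hmu, ?_⟩
  · subst hn hk
    rw [show 2 * (2 * j + 1) - 1 = 4 * j + 1 by omega]
    ring
  · obtain ⟨mu, hinv, hlast⟩ := hmu
    refine Finset.card_lt_card (Finset.ssubset_iff_of_subset ?_ |>.mpr ⟨mu, ?_, ?_⟩)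
    · exact Finset.monotone_filter_right _ fun _ _ h => h.1
    · simpa using hinv
    · simp only [Finset.mem_filter, not_and, not_lt]
      exact fun _ _ => hlast
end
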